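/- arXiv:math/0212280 — 2 statements merged into one kernel-verified Lean document; each statement's English description precedes it below -/
import Mathlib

section
/- If a finite group G acts freely and continuously on the sphere S^n for some n ≥ 0, then every abelian subgroup of G is cyclic. -/
open Metric

/-- `Sph n` is the unit sphere `S^n`, i.e. the set of unit vectors in `ℝ^{n+1}`. -/
abbrev Sph (n : ℕ) : Type := Metric.sphere (0 : EuclideanSpace ℝ (Fin (n + 1))) 1

/-- The self-homeomorphisms of a topological space form a group under composition.
A continuous action of a group `G` on `X` (every element acting by a homeomorphism)
is then precisely a group homomorphism `G →* (X ≃ₜ X)`. -/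
instance homeoGroup (X : Type*) [TopologicalSpace X] : Group (X ≃ₜ X) where
  mul e f := f.trans e
  one := Homeomorph.refl X
  inv := Homeomorph.symm
  mul_assoc _ _ _ := Homeomorph.ext fun _ => rfl
  one_mul _ := Homeomorph.ext fun _ => rfl
  mul_one _ := Homeomorph.ext fun _ => rfl
  inv_mul_cancel e := Homeomorph.ext fun x => e.symm_apply_apply x

namespace SmallChain

section Chains

variable {R : Type*} [Field R] {α β : Type*}

/-- Prepending a vertex to every tuple of a chain. -/
noncomputable def cone (a : α) : (List α →₀ R) →ₗ[R] (List α →₀ R) :=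
  Finsupp.lmapDomain R R (List.cons a)

/-- The alternating sum of the faces of a tuple; the empty tuple has degree `-1`. -/
noncomputable def faceSum : List α → (List α →₀ R)
  | [] => 0
  | a :: l => Finsupp.single l 1 - cone a (faceSum l)

/-- The boundary operator of the augmented complex of ordered chains on the points of `α`. -/
noncomputable def bdry : (List α →₀ R) →ₗ[R] (List α →₀ R) :=
  Finsupp.linearCombination R faceSum

/-- The chain map induced by a map of points. -/
noncomputable def push (f : α → β) : (List α →₀ R) →ₗ[R] (List β →₀ R) :=
  Finsupp.lmapDomain R R (List.map f)

/-- The prism over a tuple, joining its images under `f` and `g`. -/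
noncomputable def prismSum (f g : α → β) : List α → (List β →₀ R)
  | [] => 0
  | a :: l => Finsupp.single (f a :: g a :: l.map g) 1 - cone (f a) (prismSum f g l)

/-- The prism operator, a chain homotopy between `push f` and `push g`. -/
noncomputable def prism (f g : α → β) : (List α →₀ R) →ₗ[R] (List β →₀ R) :=
  Finsupp.linearCombination R (prismSum f g)

@[simp] lemma cone_single (a : α) (l : List α) (r : R) :
    cone a (Finsupp.single l r) = Finsupp.single (a :: l) r := by
  simp [cone]

@[simp] lemma push_single (f : α → β) (l : List α) (r : R) :
    push f (Finsupp.single l r) = Finsupp.single (l.map f) r := by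
  simp [push]

@[simp] lemma bdry_single (l : List α) :
    bdry (Finsupp.single l (1 : R)) = faceSum l := by
  simp [bdry]

@[simp] lemma prism_single (f g : α → β) (l : List α) :
    prism f g (Finsupp.single l (1 : R)) = prismSum f g l := by
  simp [prism]

lemma push_cone (f : α → β) (a : α) (c : List α →₀ R) :
    push f (cone a c) = cone (f a) (push f c) := by
  suffices (push f).comp (cone a) = (cone (f a)).comp (push (R := R) f) from
    LinearMap.congr_fun this c
  ext l : 3
  simp

lemma bdry_cone (a : α) (c : List α →₀ R) : bdry (cone a c) = c - cone a (bdry c) := by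
  suffices bdry.comp (cone a) = LinearMap.id - (cone a).comp (bdry (R := R)) from
    LinearMap.congr_fun this c
  ext l : 3
  simp [faceSum]

lemma bdry_faceSum (l : List α) : bdry (faceSum l : List α →₀ R) = 0 := by
  induction l with
  | nil => simp [faceSum]
  | cons a l ih => simp [faceSum, bdry_cone, ih]

lemma bdry_bdry (c : List α →₀ R) : bdry (bdry c) = 0 := by
  suffices bdry.comp (bdry (R := R) (α := α)) = 0 from LinearMap.congr_fun this c
  ext l : 3
  simp [bdry_faceSum]

lemma push_faceSum (f : α → β) (l : List α) :
    push f (faceSum l : List α →₀ R) = faceSum (l.map f) := by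
  induction l with
  | nil => simp [faceSum]
  | cons a l ih => simp [faceSum, push_cone, ih]

lemma bdry_push (f : α → β) (c : List α →₀ R) : bdry (push f c) = push f (bdry c) := by
  suffices bdry.comp (push f) = (push f).comp (bdry (R := R)) from LinearMap.congr_fun this c
  ext l : 3
  simp [push_faceSum]

lemma prism_cone (f g : α → β) (a : α) (c : List α →₀ R) :
    prism f g (cone a c) = cone (f a) (cone (g a) (push g c)) - cone (f a) (prism f g c) := by
  suffices (prism f g).comp (cone a) = (cone (f a)).comp ((cone (g a)).comp (push g)) -
      (cone (f a)).comp (prism (R := R) f g) from LinearMap.congr_fun this c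
  ext l : 3
  simp [prismSum]

lemma bdry_prismSum (f g : α → β) (l : List α) :
    bdry (prismSum f g l : List β →₀ R) =
      Finsupp.single (l.map g) 1 - Finsupp.single (l.map f) 1 - prism f g (faceSum l) := by
  induction l with
  | nil => simp [prismSum, faceSum]
  | cons a l ih =>
    simp only [prismSum, faceSum, map_sub, bdry_single, bdry_cone, ih, prism_cone, prism_single,
      cone_single, List.map_cons, push_faceSum]
    abel

lemma bdry_prism (f g : α → β) (c : List α →₀ R) :
    bdry (prism f g c) = push g c - push f c - prism f g (bdry c) := by
  suffices bdry.comp (prism f g) = push g - push f - (prism f g).comp (bdry (R := R)) from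
    LinearMap.congr_fun this c
  ext l : 3
  simp [bdry_prismSum]

lemma push_push {γ : Type*} (g : β → γ) (f : α → β) (c : List α →₀ R) :
    push g (push f c) = push (g ∘ f) c := by
  suffices (push g).comp (push f) = push (R := R) (g ∘ f) from LinearMap.congr_fun this c
  ext l : 3
  simp

lemma push_id (c : List α →₀ R) : push id c = c := by
  suffices push (R := R) (id : α → α) = LinearMap.id from LinearMap.congr_fun this c
  ext l : 3
  simp

lemma cone_mem_supported {s t : Set (List α)} {a : α} (h : ∀ l ∈ s, a :: l ∈ t)
    {c : List α →₀ R} (hc : c ∈ Finsupp.supported R R s) :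
    cone a c ∈ Finsupp.supported R R t := by
  refine Finsupp.supported_mono ?_ (Finsupp.lmapDomain_supported R R (List.cons a) s ▸
    Submodule.mem_map_of_mem hc)
  rintro _ ⟨l, hl, rfl⟩
  exact h l hl

lemma faceSum_mem (l : List α) :
    (faceSum l : List α →₀ R) ∈
      Finsupp.supported R R {l' | l'.length + 1 = l.length ∧ l' ⊆ l} := by
  induction l with
  | nil => simp [faceSum]
  | cons a l ih =>
    refine Submodule.sub_mem _ (Finsupp.single_mem_supported R _ ?_) (cone_mem_supported ?_ ih)
    · simp
    · rintro l' ⟨h1, h2⟩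
      exact ⟨by simp [h1], List.cons_subset_cons a h2⟩

lemma prismSum_mem (f g : α → β) (l : List α) :
    (prismSum f g l : List β →₀ R) ∈
      Finsupp.supported R R {l' | l'.length = l.length + 1 ∧ l' ⊆ l.map f ++ l.map g} := by
  induction l with
  | nil => simp [prismSum]
  | cons a l ih =>
    refine Submodule.sub_mem _ (Finsupp.single_mem_supported R _ ?_) (cone_mem_supported ?_ ih)
    · refine ⟨by simp, fun b hb => ?_⟩
      simp only [List.mem_cons, List.map_cons, List.mem_append] at hb ⊢
      tauto
    · rintro l' ⟨h1, h2⟩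
      refine ⟨by simp [h1], fun b hb => ?_⟩
      have := @h2 b
      simp only [List.mem_cons, List.map_cons, List.mem_append] at hb this ⊢
      tauto

end Chains

section Small

variable (R : Type*) [Field R] {α β : Type*} [PseudoMetricSpace α] [PseudoMetricSpace β]

/-- The tuples of `k` points of `A` with pairwise distances less than `ε`. -/
def smallTuples (A : Set α) (ε : ℝ) (k : ℕ) : Set (List α) :=
  {l | l.length = k ∧ (∀ a ∈ l, a ∈ A) ∧ ∀ a ∈ l, ∀ b ∈ l, dist a b < ε}

/-- The chains all of whose tuples lie in `smallTuples A ε k`. -/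
def smallChains (A : Set α) (ε : ℝ) (k : ℕ) : Submodule R (List α →₀ R) :=
  Finsupp.supported R R (smallTuples A ε k)

variable {R}

/-- A linear map sends a chain into a submodule as soon as it does so for its tuples. -/
lemma map_mem_of_mem {M : Type*} [AddCommGroup M] [Module R M] (f : (List α →₀ R) →ₗ[R] M)
    {A : Set α} {ε : ℝ} {k : ℕ} {N : Submodule R M}
    (h : ∀ l ∈ smallTuples A ε k, f (Finsupp.single l 1) ∈ N)
    {c : List α →₀ R} (hc : c ∈ smallChains R A ε k) : f c ∈ N := by
  rw [smallChains, Finsupp.supported_eq_span_single] at hc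
  have : Submodule.span R ((fun l => Finsupp.single l (1 : R)) '' smallTuples A ε k) ≤
      N.comap f := by
    rw [Submodule.span_le]
    rintro _ ⟨l, hl, rfl⟩
    exact h l hl
  exact this hc

lemma map_congr_of_mem {M : Type*} [AddCommGroup M] [Module R M] {f g : (List α →₀ R) →ₗ[R] M}
    {A : Set α} {ε : ℝ} {k : ℕ}
    (h : ∀ l ∈ smallTuples A ε k, f (Finsupp.single l 1) = g (Finsupp.single l 1))
    {c : List α →₀ R} (hc : c ∈ smallChains R A ε k) : f c = g c := by
  have := map_mem_of_mem (f - g) (N := ⊥) (fun l hl => by simp [h l hl]) hc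
  simpa [sub_eq_zero] using this

lemma single_mem {A : Set α} {ε : ℝ} {k : ℕ} {l : List α} (hl : l ∈ smallTuples A ε k) (r : R) :
    Finsupp.single l r ∈ smallChains R A ε k :=
  Finsupp.single_mem_supported R r hl

lemma smallTuples_mono {A B : Set α} {δ ε : ℝ} (hAB : A ⊆ B) (h : δ ≤ ε) (k : ℕ) :
    smallTuples A δ k ⊆ smallTuples B ε k :=
  fun _ hl => ⟨hl.1, fun a ha => hAB (hl.2.1 a ha), fun a ha b hb => (hl.2.2 a ha b hb).trans_le h⟩

lemma smallChains_mono {A B : Set α} {δ ε : ℝ} (hAB : A ⊆ B) (h : δ ≤ ε) (k : ℕ) :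
    smallChains R A δ k ≤ smallChains R B ε k :=
  Finsupp.supported_mono (smallTuples_mono hAB h k)

lemma smallChains_inter {A B : Set α} {ε : ℝ} {k : ℕ} {c : List α →₀ R}
    (hA : c ∈ smallChains R A ε k) (hB : c ∈ smallChains R B ε k) :
    c ∈ smallChains R (A ∩ B) ε k := by
  intro l hl
  exact ⟨(hA hl).1, fun a ha => ⟨(hA hl).2.1 a ha, (hB hl).2.1 a ha⟩, (hA hl).2.2⟩

lemma bdry_mem {A : Set α} {ε : ℝ} {k : ℕ} {c : List α →₀ R}
    (hc : c ∈ smallChains R A ε (k + 1)) : bdry c ∈ smallChains R A ε k := by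
  refine map_mem_of_mem bdry (fun l hl => ?_) hc
  rw [bdry_single]
  refine Finsupp.supported_mono ?_ (faceSum_mem l)
  rintro l' ⟨h1, h2⟩
  refine ⟨?_, fun a ha => hl.2.1 a (h2 ha), fun a ha b hb => hl.2.2 a (h2 ha) b (h2 hb)⟩
  have := hl.1
  omega

lemma bdry_eq_zero_of_mem_zero {A : Set α} {ε : ℝ} {c : List α →₀ R}
    (hc : c ∈ smallChains R A ε 0) : bdry c = 0 := by
  refine map_congr_of_mem (g := 0) (fun l hl => ?_) hc
  obtain rfl := List.length_eq_zero_iff.mp hl.1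
  simp [faceSum]

lemma push_mem {A : Set α} {B : Set β} {δ ε : ℝ} {f : α → β} (hf : ∀ a ∈ A, f a ∈ B)
    (hd : ∀ a ∈ A, ∀ b ∈ A, dist a b < δ → dist (f a) (f b) < ε) {k : ℕ} {c : List α →₀ R}
    (hc : c ∈ smallChains R A δ k) : push f c ∈ smallChains R B ε k := by
  refine map_mem_of_mem (push f) (fun l hl => ?_) hc
  rw [push_single]
  refine single_mem ⟨by simp [hl.1], ?_, ?_⟩ _
  · simp only [List.mem_map]
    rintro _ ⟨a, ha, rfl⟩
    exact hf a (hl.2.1 a ha)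
  · simp only [List.mem_map]
    rintro _ ⟨a, ha, rfl⟩ _ ⟨b, hb, rfl⟩
    exact hd a (hl.2.1 a ha) b (hl.2.1 b hb) (hl.2.2 a ha b hb)

lemma push_congr {γ : Type*} {A : Set α} {δ : ℝ} {f g : α → γ} (hfg : ∀ a ∈ A, f a = g a) {k : ℕ}
    {c : List α →₀ R} (hc : c ∈ smallChains R A δ k) : push f c = push g c := by
  refine map_congr_of_mem (fun l hl => ?_) hc
  rw [push_single, push_single, List.map_congr_left fun a ha => hfg a (hl.2.1 a ha)]

lemma prism_mem {A : Set α} {B : Set β} {δ ε : ℝ} {f g : α → β} (hf : ∀ a ∈ A, f a ∈ B)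
    (hg : ∀ a ∈ A, g a ∈ B)
    (hff : ∀ a ∈ A, ∀ b ∈ A, dist a b < δ → dist (f a) (f b) < ε)
    (hgg : ∀ a ∈ A, ∀ b ∈ A, dist a b < δ → dist (g a) (g b) < ε)
    (hfg : ∀ a ∈ A, ∀ b ∈ A, dist a b < δ → dist (f a) (g b) < ε)
    {k : ℕ} {c : List α →₀ R} (hc : c ∈ smallChains R A δ k) :
    prism f g c ∈ smallChains R B ε (k + 1) := by
  refine map_mem_of_mem (prism f g) (fun l hl => ?_) hc
  rw [prism_single]
  refine Finsupp.supported_mono ?_ (prismSum_mem f g l)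
  rintro l' ⟨h1, h2⟩
  have key : ∀ x ∈ l', ∃ a ∈ l, x = f a ∨ x = g a := by
    intro x hx
    have := h2 hx
    simp only [List.mem_append, List.mem_map] at this
    grind
  refine ⟨by rw [h1, hl.1], fun x hx => ?_, fun x hx y hy => ?_⟩
  · obtain ⟨a, ha, rfl | rfl⟩ := key x hx
    exacts [hf a (hl.2.1 a ha), hg a (hl.2.1 a ha)]
  · obtain ⟨a, ha, rfl | rfl⟩ := key x hx <;> obtain ⟨b, hb, rfl | rfl⟩ := key y hy
    · exact hff a (hl.2.1 a ha) b (hl.2.1 b hb) (hl.2.2 a ha b hb)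
    · exact hfg a (hl.2.1 a ha) b (hl.2.1 b hb) (hl.2.2 a ha b hb)
    · rw [dist_comm]
      exact hfg b (hl.2.1 b hb) a (hl.2.1 a ha) (hl.2.2 b hb a ha)
    · exact hgg a (hl.2.1 a ha) b (hl.2.1 b hb) (hl.2.2 a ha b hb)

/-- Among any `d + 1` cycles on `k` points in `A`, some nontrivial linear combination bounds
in `B`, provided that the cycles are small; the bounding chain can be made small too. -/
def BoundsUpTo (R : Type*) [Field R] (A B : Set α) (k d : ℕ) : Prop :=
  ∀ ε > 0, ∃ δ > 0, ∀ z : Fin (d + 1) → (List α →₀ R),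
    (∀ i, z i ∈ smallChains R A δ k) → (∀ i, bdry (z i) = 0) →
      ∃ a : Fin (d + 1) → R, a ≠ 0 ∧ ∃ w ∈ smallChains R B ε (k + 1), bdry w = ∑ i, a i • z i

lemma BoundsUpTo.exists_bdry_eq {A B : Set α} {k : ℕ} (h : BoundsUpTo R A B k 0)
    {ε : ℝ} (hε : 0 < ε) :
    ∃ δ > 0, ∀ z ∈ smallChains R A δ k, bdry z = 0 →
      ∃ w ∈ smallChains R B ε (k + 1), bdry w = z := by
  obtain ⟨δ, hδ, H⟩ := h ε hε
  refine ⟨δ, hδ, fun z hz hz0 => ?_⟩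
  obtain ⟨a, ha, w, hw, hwz⟩ := H (fun _ => z) (fun _ => hz) fun _ => hz0
  have ha0 : a 0 ≠ 0 := fun h0 => ha (funext fun i => by rw [Fin.fin_one_eq_zero i]; exact h0)
  refine ⟨(a 0)⁻¹ • w, Submodule.smul_mem _ _ hw, ?_⟩
  simp [hwz, smul_smul, inv_mul_cancel₀ ha0]

/-- Homotopic maps have homologous images of small cycles. -/
lemma exists_bdry_eq_push_sub {A : Set α} {B : Set β} (hA : IsCompact A) (h : ℝ → α → β)
    (hc : ContinuousOn (fun q : ℝ × α => h q.1 q.2) (Set.Icc 0 1 ×ˢ A))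
    (hB : ∀ s ∈ Set.Icc (0 : ℝ) 1, ∀ a ∈ A, h s a ∈ B) {ε : ℝ} (hε : 0 < ε) :
    ∃ δ > 0, ∀ k, ∀ z ∈ smallChains R A δ k, bdry z = 0 →
      ∃ w ∈ smallChains R B ε (k + 1), bdry w = push (h 1) z - push (h 0) z := by
  have hu := (isCompact_Icc.prod hA).uniformContinuousOn_of_continuous hc
  rw [Metric.uniformContinuousOn_iff] at hu
  obtain ⟨δ, hδ, H⟩ := hu ε hε
  refine ⟨δ, hδ, fun k z hz hz0 => ?_⟩
  obtain ⟨N, hN⟩ := exists_nat_one_div_lt hδ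
  have hN0 : (0 : ℝ) < N + 1 := by positivity
  have key : ∀ j : ℕ, j ≤ N + 1 → ∃ w ∈ smallChains R B ε (k + 1),
      bdry w = push (h (j / (N + 1))) z - push (h 0) z := by
    intro j
    induction j with
    | zero => exact fun _ => ⟨0, Submodule.zero_mem _, by simp⟩
    | succ j ih =>
      intro hj
      obtain ⟨w, hw, hwz⟩ := ih (by omega)
      have hj' : ((j : ℝ) + 1) ≤ N + 1 := by exact_mod_cast hj
      have m0 : (j : ℝ) / (N + 1) ∈ Set.Icc (0 : ℝ) 1 :=
        ⟨by positivity, by rw [div_le_one hN0]; linarith⟩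
      have m1 : ((j + 1 : ℕ) : ℝ) / (N + 1) ∈ Set.Icc (0 : ℝ) 1 :=
        ⟨by positivity, by rw [div_le_one hN0]; push_cast; linarith⟩
      have hd : dist ((j : ℝ) / (N + 1)) (((j + 1 : ℕ) : ℝ) / (N + 1)) < δ := by
        rw [Real.dist_eq, ← sub_div, abs_div, abs_of_pos hN0]
        push_cast
        simpa using hN
      have hsame : ∀ s ∈ Set.Icc (0 : ℝ) 1, ∀ a ∈ A, ∀ b ∈ A, dist a b < δ →
          dist (h s a) (h s b) < ε := fun s hs a ha b hb hab =>
        H (s, a) ⟨hs, ha⟩ (s, b) ⟨hs, hb⟩ (by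
          rw [Prod.dist_eq]
          exact max_lt (by simpa using hδ) hab)
      refine ⟨w + prism (h (j / (N + 1))) (h ((j + 1 : ℕ) / (N + 1))) z,
        Submodule.add_mem _ hw (prism_mem (hB _ m0) (hB _ m1) (hsame _ m0) (hsame _ m1)
          (fun a ha b hb hab => H (_, a) ⟨m0, ha⟩ (_, b) ⟨m1, hb⟩ ?_) hz), ?_⟩
      · rw [Prod.dist_eq]
        exact max_lt hd hab
      · rw [map_add, hwz, bdry_prism, hz0, map_zero]
        abel
  obtain ⟨w, hw, hwz⟩ := key (N + 1) le_rfl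
  refine ⟨w, hw, ?_⟩
  rw [hwz]
  push_cast
  rw [div_self hN0.ne']

/-- Small cycles of a compact set bound where the set can be contracted. -/
lemma exists_bdry_eq_of_contraction {A B : Set α} (hA : IsCompact A) (h : ℝ → α → α)
    (hc : ContinuousOn (fun q : ℝ × α => h q.1 q.2) (Set.Icc 0 1 ×ˢ A))
    (hB : ∀ s ∈ Set.Icc (0 : ℝ) 1, ∀ a ∈ A, h s a ∈ B) (h0 : ∀ a ∈ A, h 0 a = a)
    {e : α} (he : e ∈ B) (h1 : ∀ a ∈ A, h 1 a = e) {ε : ℝ} (hε : 0 < ε) :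
    ∃ δ > 0, ∀ k, ∀ z ∈ smallChains R A δ k, bdry z = 0 →
      ∃ w ∈ smallChains R B ε (k + 1), bdry w = z := by
  obtain ⟨δ, hδ, H⟩ := exists_bdry_eq_push_sub (R := R) hA h hc hB hε
  refine ⟨δ, hδ, fun k z hz hz0 => ?_⟩
  obtain ⟨w, hw, hwz⟩ := H k z hz hz0
  rw [push_congr (g := id) h0 hz, push_id] at hwz
  have hz1 : push (h 1) z ∈ smallChains R {e} ε k :=
    push_mem (fun a ha => h1 a ha) (fun a ha b hb _ => by simpa [h1 a ha, h1 b hb] using hε) hz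
  refine ⟨cone e (push (h 1) z) - w, Submodule.sub_mem _ (cone_mem_supported ?_ hz1) hw, ?_⟩
  · rintro l ⟨l1, l2, -⟩
    have : ∀ a ∈ e :: l, a = e := by simpa using l2
    refine ⟨by simp [l1], fun a ha => this a ha ▸ he, fun a ha b hb => ?_⟩
    rw [this a ha, this b hb, dist_self]
    exact hε
  · rw [map_sub, bdry_cone, bdry_push, hz0, hwz]
    simp

end Small

section Sphere

variable {R : Type*} [Field R] {W : Type*} [NormedAddCommGroup W] [InnerProductSpace ℝ W]

/-- The unit sphere of a subspace. -/
def unitSphere (U : Submodule ℝ W) : Set W := Metric.sphere 0 1 ∩ U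

lemma norm_eq_one {U : Submodule ℝ W} {x : W} (hx : x ∈ unitSphere U) : ‖x‖ = 1 := by
  simpa using hx.1

lemma isCompact_unitSphere [FiniteDimensional ℝ W] (U : Submodule ℝ W) :
    IsCompact (unitSphere U) :=
  (isCompact_sphere _ _).inter_right U.closed_of_finiteDimensional

lemma inv_norm_smul_mem {U : Submodule ℝ W} {v : W} (hv : v ∈ U) (h0 : v ≠ 0) :
    ‖v‖⁻¹ • v ∈ unitSphere U := by
  refine ⟨?_, U.smul_mem _ hv⟩
  simp [norm_smul, h0]

lemma isCompact_halfSphere [FiniteDimensional ℝ W] (U : Submodule ℝ W) (e : W) (c : ℝ) :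
    IsCompact {x ∈ unitSphere U | c ≤ inner ℝ e x} :=
  (isCompact_unitSphere U).inter_right
    (isClosed_le (g := fun x => inner ℝ e x) continuous_const (by fun_prop))

lemma exists_bdry_eq_of_halfSphere [FiniteDimensional ℝ W] {U : Submodule ℝ W} {e : W}
    (he : e ∈ unitSphere U) {ε : ℝ} (hε : 0 < ε) :
    ∃ δ > 0, ∀ k, ∀ z ∈ smallChains R {x ∈ unitSphere U | -(3 / 4) ≤ inner ℝ e x} δ k,
      bdry z = 0 → ∃ w ∈ smallChains R (unitSphere U) ε (k + 1), bdry w = z := by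
  have hne : ∀ s ∈ Set.Icc (0 : ℝ) 1, ∀ x ∈ {x ∈ unitSphere U | -(3 / 4) ≤ inner ℝ e x},
      (1 - s) • x + s • e ≠ 0 := by
    rintro s ⟨hs0, hs1⟩ x ⟨hx, hxe⟩ h
    have h2 : ‖(1 - s) • x + s • e‖ ^ 2 = 0 := by rw [h]; simp
    rw [norm_add_sq_real, norm_smul, norm_smul, norm_eq_one hx, norm_eq_one he, inner_smul_left,
      inner_smul_right, real_inner_comm] at h2
    simp only [mul_one, Real.norm_eq_abs, sq_abs, conj_trivial] at h2
    nlinarith [mul_le_mul_of_nonneg_left hxe (mul_nonneg hs0 (sub_nonneg.2 hs1)),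
      sq_nonneg (2 * s - 1)]
  refine exists_bdry_eq_of_contraction (isCompact_halfSphere U e _)
    (fun s x => ‖(1 - s) • x + s • e‖⁻¹ • ((1 - s) • x + s • e)) ?_ ?_ ?_ he ?_ hε
  · refine ContinuousOn.smul (ContinuousOn.inv₀ (by fun_prop) ?_) (by fun_prop)
    rintro ⟨s, x⟩ ⟨hs, hx⟩
    exact norm_ne_zero_iff.2 (hne s hs x hx)
  · intro s hs x hx
    exact inv_norm_smul_mem (U.add_mem (U.smul_mem _ hx.1.2) (U.smul_mem _ he.2)) (hne s hs x hx)
  · intro x hx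
    simp [norm_eq_one hx.1]
  · intro x hx
    simp [norm_eq_one he]

/-- The part of the unit sphere at height at most `c`. -/
def band (U : Submodule ℝ W) (e : W) (c : ℝ) : Set W := {x ∈ unitSphere U | |inner ℝ e x| ≤ c}

lemma BoundsUpTo.band [FiniteDimensional ℝ W] {U V : Submodule ℝ W} {e : W} {k d : ℕ}
    (hUV : U ≤ V) (he : e ∈ unitSphere V) (hUe : ∀ x ∈ U, inner ℝ e x = 0)
    (hproj : ∀ x ∈ V, x - (inner ℝ e x) • e ∈ U)
    (h : BoundsUpTo R (unitSphere U) (unitSphere U) k d) :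
    BoundsUpTo R (band V e (1 / 2)) (SmallChain.band V e (3 / 4)) k d := by
  intro ε hε
  set H : ℝ → W → W := fun s x =>
    ‖x - (s * inner ℝ e x) • e‖⁻¹ • (x - (s * inner ℝ e x) • e) with hH
  have hee : inner ℝ e e = 1 := by rw [real_inner_self_eq_norm_sq, norm_eq_one he]; norm_num
  have hnorm : ∀ s ∈ Set.Icc (0 : ℝ) 1, ∀ x ∈ SmallChain.band V e (1 / 2),
      3 / 4 ≤ ‖x - (s * inner ℝ e x) • e‖ := by
    rintro s ⟨hs0, hs1⟩ x ⟨hx, hxe⟩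
    refine le_of_sq_le_sq ?_ (norm_nonneg _)
    have h2 : (inner ℝ e x) ^ 2 ≤ 1 / 4 := by
      rw [← sq_abs]
      nlinarith [abs_nonneg (inner ℝ e x)]
    rw [norm_sub_sq_real, norm_smul, norm_eq_one hx, norm_eq_one he, inner_smul_right,
      real_inner_comm e x, mul_one, Real.norm_eq_abs, sq_abs]
    nlinarith [mul_le_mul_of_nonneg_left h2 (mul_nonneg hs0 (by linarith : 0 ≤ 2 - s)),
      sq_nonneg (s - 1)]
  have hne : ∀ s ∈ Set.Icc (0 : ℝ) 1, ∀ x ∈ SmallChain.band V e (1 / 2),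
      x - (s * inner ℝ e x) • e ≠ 0 := by
    intro s hs x hx h0
    have := hnorm s hs x hx
    rw [h0, norm_zero] at this
    norm_num at this
  have hA : IsCompact (SmallChain.band V e (1 / 2)) :=
    (isCompact_unitSphere V).inter_right
      (isClosed_le (f := fun x => |inner ℝ e x|) (by fun_prop) continuous_const)
  have hc : ContinuousOn (fun q : ℝ × W => H q.1 q.2)
      (Set.Icc 0 1 ×ˢ SmallChain.band V e (1 / 2)) := by
    refine ContinuousOn.smul (ContinuousOn.inv₀ (by fun_prop) ?_) (by fun_prop)
    rintro ⟨s, x⟩ ⟨hs, hx⟩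
    exact norm_ne_zero_iff.2 (hne s hs x hx)
  have hmem : ∀ s ∈ Set.Icc (0 : ℝ) 1, ∀ x ∈ SmallChain.band V e (1 / 2),
      H s x ∈ SmallChain.band V e (3 / 4) := by
    intro s hs x hx
    refine ⟨inv_norm_smul_mem (V.sub_mem hx.1.2 (V.smul_mem _ he.2)) (hne s hs x hx), ?_⟩
    have hn := hnorm s hs x hx
    rw [inner_smul_right, inner_sub_right, inner_smul_right, hee, mul_one, abs_mul, abs_inv,
      abs_norm, inv_mul_le_iff₀ (by linarith),
      show (inner ℝ e x) - s * (inner ℝ e x) = (1 - s) * (inner ℝ e x) by ring, abs_mul,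
      abs_of_nonneg (by linarith [hs.2] : 0 ≤ 1 - s)]
    nlinarith [hx.2, hs.1, hs.2, abs_nonneg (inner ℝ e x)]
  have hone : ∀ x ∈ SmallChain.band V e (1 / 2), H 1 x ∈ unitSphere U := by
    intro x hx
    refine inv_norm_smul_mem ?_ (hne 1 (by simp) x hx)
    rw [one_mul]
    exact hproj x hx.1.2
  have hzero : ∀ x ∈ SmallChain.band V e (1 / 2), H 0 x = id x := by
    intro x hx
    simp [hH, norm_eq_one hx.1]
  obtain ⟨δ₁, hδ₁, h₁⟩ := exists_bdry_eq_push_sub (R := R) hA H hc hmem hε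
  obtain ⟨δ₂, hδ₂, h₂⟩ := h ε hε
  have hc1 : ContinuousOn (H 1) (SmallChain.band V e (1 / 2)) :=
    hc.comp (f := fun x => ((1 : ℝ), x)) (by fun_prop) fun x hx => ⟨by simp, hx⟩
  obtain ⟨δ₃, hδ₃, h₃⟩ :=
    Metric.uniformContinuousOn_iff.1 (hA.uniformContinuousOn_of_continuous hc1) δ₂ hδ₂
  refine ⟨min δ₁ δ₃, lt_min hδ₁ hδ₃, fun z hz hz0 => ?_⟩
  obtain ⟨a, ha, w, hw, hwz⟩ := h₂ (fun i => push (H 1) (z i))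
    (fun i => push_mem hone (fun x hx y hy hxy => h₃ x hx y hy (hxy.trans_le (min_le_right _ _)))
      (hz i)) (fun i => by rw [bdry_push, hz0, map_zero])
  choose v hv hvz using fun i =>
    h₁ k (z i) (smallChains_mono subset_rfl (min_le_left _ _) _ (hz i)) (hz0 i)
  refine ⟨a, ha, w - ∑ i, a i • v i, Submodule.sub_mem _ (smallChains_mono ?_ le_rfl _ hw)
    (Submodule.sum_mem _ fun i _ => Submodule.smul_mem _ _ (hv i)), ?_⟩
  · intro x hx
    refine ⟨⟨hx.1, hUV hx.2⟩, ?_⟩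
    rw [hUe x hx.2]
    norm_num
  · have : ∀ i, push (H 0) (z i) = z i := fun i => by rw [push_congr hzero (hz i), push_id]
    simp only [map_sub, map_sum, map_smul, hwz, hvz, this, smul_sub, Finset.sum_sub_distrib]
    abel

lemma BoundsUpTo.unitSphere_succ [FiniteDimensional ℝ W] {U V : Submodule ℝ W} {e : W} {k d : ℕ}
    (hUV : U ≤ V) (he : e ∈ unitSphere V) (hUe : ∀ x ∈ U, inner ℝ e x = 0)
    (hproj : ∀ x ∈ V, x - (inner ℝ e x) • e ∈ U)
    (h : BoundsUpTo R (unitSphere U) (unitSphere U) k d) :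
    BoundsUpTo R (unitSphere V) (unitSphere V) (k + 1) d := by
  classical
  intro ε hε
  have hne : -e ∈ unitSphere V := ⟨by simpa using he.1, V.neg_mem he.2⟩
  obtain ⟨δ₁, hδ₁, h₁⟩ := exists_bdry_eq_of_halfSphere (R := R) he hε
  obtain ⟨δ₂, hδ₂, h₂⟩ := exists_bdry_eq_of_halfSphere (R := R) hne hε
  obtain ⟨δ₃, hδ₃, h₃⟩ := h.band hUV he hUe hproj (min δ₁ δ₂) (lt_min hδ₁ hδ₂)
  set δ := min (min δ₁ δ₂) (min δ₃ 1) with hδdef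
  have hδ12 : δ ≤ min δ₁ δ₂ := min_le_left _ _
  have hδ3 : δ ≤ δ₃ := (min_le_right _ _).trans (min_le_left _ _)
  have hδ1 : δ ≤ 1 := (min_le_right _ _).trans (min_le_right _ _)
  refine ⟨δ, lt_min (lt_min hδ₁ hδ₂) (lt_min hδ₃ one_pos), fun z hz hz0 => ?_⟩
  set P : List W → Prop := fun l => ∀ x ∈ l, -(1 / 2) ≤ inner ℝ e x with hP
  set zp : Fin (d + 1) → (List W →₀ R) := fun i => (z i).filter P with hzp
  set zm : Fin (d + 1) → (List W →₀ R) := fun i => (z i).filter fun l => ¬ P l with hzm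
  have hsum : ∀ i, zp i + zm i = z i := fun i => Finsupp.filter_add_filter_not _ _
  have hzpA : ∀ i, zp i ∈ smallChains R {x ∈ unitSphere V | -(1 / 2) ≤ inner ℝ e x} δ (k + 1) := by
    intro i l hl
    have hl' : l ∈ (z i).support ∧ P l := by simpa [hzp] using hl
    have := hz i hl'.1
    exact ⟨this.1, fun x hx => ⟨this.2.1 x hx, hl'.2 x hx⟩, this.2.2⟩
  have hzmA : ∀ i, zm i ∈ smallChains R {x ∈ unitSphere V | -(1 / 2) ≤ inner ℝ (-e) x} δ
      (k + 1) := by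
    intro i l hl
    have hl' : l ∈ (z i).support ∧ ¬ P l := by simpa [hzm] using hl
    have hl1 := hz i hl'.1
    refine ⟨hl1.1, fun x hx => ⟨hl1.2.1 x hx, ?_⟩, hl1.2.2⟩
    obtain ⟨y, hy, hye⟩ : ∃ y ∈ l, inner ℝ e y < -(1 / 2) := by simpa [hP] using hl'.2
    have h3 : (inner ℝ e x) - (inner ℝ e y) ≤ 1 := by
      rw [← inner_sub_right]
      refine (real_inner_le_norm _ _).trans ?_
      rw [norm_eq_one he, one_mul, ← dist_eq_norm]
      exact (hl1.2.2 x hx y hy).le.trans hδ1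
    rw [inner_neg_left]
    linarith
  have hbdry : ∀ i, bdry (zp i) = - bdry (zm i) := fun i => by
    rw [eq_neg_iff_add_eq_zero, ← map_add, hsum, hz0]
  have hband : ∀ i, bdry (zp i) ∈ smallChains R (SmallChain.band V e (1 / 2)) δ₃ k := by
    intro i
    have m1 := bdry_mem (hzpA i)
    have m2 : bdry (zp i) ∈ smallChains R {x ∈ unitSphere V | -(1 / 2) ≤ inner ℝ (-e) x} δ k := by
      rw [hbdry]
      exact Submodule.neg_mem _ (bdry_mem (hzmA i))
    refine smallChains_mono ?_ hδ3 _ (smallChains_inter m1 m2)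
    rintro x ⟨⟨hx, h4⟩, -, h5⟩
    refine ⟨hx, abs_le.2 ⟨h4, ?_⟩⟩
    rw [inner_neg_left] at h5
    linarith
  obtain ⟨a, ha, w, hw, hwz⟩ := h₃ (fun i => bdry (zp i)) hband fun i => bdry_bdry _
  have hup : ∑ i, a i • zp i - w ∈
      smallChains R {x ∈ unitSphere V | -(3 / 4) ≤ inner ℝ e x} (min δ₁ δ₂) (k + 1) := by
    refine Submodule.sub_mem _ (Submodule.sum_mem _ fun i _ => Submodule.smul_mem _ _
      (smallChains_mono ?_ hδ12 _ (hzpA i))) (smallChains_mono ?_ le_rfl _ hw)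
    · exact fun x hx => ⟨hx.1, by linarith [hx.2]⟩
    · exact fun x hx => ⟨hx.1, (abs_le.1 hx.2).1⟩
  have hdown : ∑ i, a i • zm i + w ∈
      smallChains R {x ∈ unitSphere V | -(3 / 4) ≤ inner ℝ (-e) x} (min δ₁ δ₂) (k + 1) := by
    refine Submodule.add_mem _ (Submodule.sum_mem _ fun i _ => Submodule.smul_mem _ _
      (smallChains_mono ?_ hδ12 _ (hzmA i))) (smallChains_mono ?_ le_rfl _ hw)
    · exact fun x hx => ⟨hx.1, by linarith [hx.2]⟩
    · refine fun x hx => ⟨hx.1, ?_⟩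
      rw [inner_neg_left]
      linarith [(abs_le.1 hx.2).2]
  obtain ⟨v₁, hv₁, hv₁z⟩ := h₁ _ _ (smallChains_mono subset_rfl (min_le_left _ _) _ hup)
    (by simp [hwz])
  obtain ⟨v₂, hv₂, hv₂z⟩ := h₂ _ _ (smallChains_mono subset_rfl (min_le_right _ _) _ hdown)
    (by simp [hwz, hbdry])
  refine ⟨a, ha, v₁ + v₂, Submodule.add_mem _ hv₁ hv₂, ?_⟩
  rw [map_add, hv₁z, hv₂z]
  simp only [← hsum, smul_add, Finset.sum_add_distrib]
  abel

lemma boundsUpTo_zero {α : Type*} [PseudoMetricSpace α] {A : Set α} (hA : A.Nonempty) :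
    BoundsUpTo R A A 0 0 := by
  obtain ⟨e, he⟩ := hA
  refine fun ε hε => ⟨1, one_pos, fun z hz _ =>
    ⟨1, one_ne_zero, cone e (z 0), cone_mem_supported ?_ (hz 0), ?_⟩⟩
  · rintro l ⟨l1, -, -⟩
    obtain rfl := List.length_eq_zero_iff.mp l1
    exact ⟨rfl, by simpa using he, by simpa using hε⟩
  · rw [bdry_cone, bdry_eq_zero_of_mem_zero (hz 0)]
    simp

lemma boundsUpTo_zero_one {α : Type*} [PseudoMetricSpace α] (A : Set α) :
    BoundsUpTo R A A 0 1 := by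
  have key : ∀ c ∈ smallChains R A 1 0, c = Finsupp.single [] (c []) := by
    intro c hc
    ext l
    rcases l with - | ⟨x, l⟩
    · simp
    · rw [Finsupp.single_eq_of_ne (by simp)]
      by_contra h
      simpa using (hc (Finsupp.mem_support_iff.2 h)).1
  refine fun ε hε => ⟨1, one_pos, fun z hz _ => ?_⟩
  by_cases h : z 0 [] = 0
  · refine ⟨![1, 0], fun h1 => by simpa using congrFun h1 0, 0, Submodule.zero_mem _, ?_⟩
    rw [Fin.sum_univ_two, key _ (hz 0), h]
    simp
  · refine ⟨![z 1 [], - z 0 []], fun h1 => h (by simpa using congrFun h1 1), 0,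
      Submodule.zero_mem _, ?_⟩
    rw [Fin.sum_univ_two, key _ (hz 0), key _ (hz 1)]
    simp [mul_comm]

/-- The span of a set of basis vectors, described by the vanishing of the other coordinates. -/
def coordSubspace {ι : Type*} [Fintype ι] (b : OrthonormalBasis ι ℝ W) (s : Finset ι) :
    Submodule ℝ W where
  carrier := {x | ∀ i ∉ s, inner ℝ (b i) x = 0}
  add_mem' hx hy i hi := by rw [inner_add_right, hx i hi, hy i hi, add_zero]
  zero_mem' i _ := inner_zero_right _
  smul_mem' c x hx i hi := by rw [inner_smul_right, hx i hi, mul_zero]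

lemma BoundsUpTo.coordSubspace_insert {ι : Type*} [Fintype ι] [DecidableEq ι]
    (b : OrthonormalBasis ι ℝ W) {s : Finset ι} {i : ι} (hi : i ∉ s) {k d : ℕ}
    (h : BoundsUpTo R (unitSphere (coordSubspace b s)) (unitSphere (coordSubspace b s)) k d) :
    BoundsUpTo R (unitSphere (coordSubspace b (insert i s)))
      (unitSphere (coordSubspace b (insert i s))) (k + 1) d := by
  have := Module.Basis.finiteDimensional_of_finite b.toBasis
  refine BoundsUpTo.unitSphere_succ (U := coordSubspace b s) (V := coordSubspace b (insert i s))
    (e := b i) (fun x hx j hj => hx j fun hs => hj (by simp [hs]))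
    ⟨by simp, fun j hj => ?_⟩ (fun x hx => hx i hi) (fun x hx j hj => ?_) h
  · rw [b.inner_eq_ite, if_neg]
    rintro rfl
    simp at hj
  · rw [inner_sub_right, inner_smul_right, b.inner_eq_ite]
    split_ifs with hji
    · rw [hji]
      ring
    · rw [hx j (by simp [hj, hji])]
      ring

/-- Small cycles on the sphere bound below the top dimension. -/
lemma boundsUpTo_unitSphere_of_lt {ι : Type*} [Fintype ι] (b : OrthonormalBasis ι ℝ W) (k : ℕ)
    (s : Finset ι) (hk : k < s.card) :
    BoundsUpTo R (unitSphere (coordSubspace b s)) (unitSphere (coordSubspace b s)) k 0 := by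
  classical
  induction k generalizing s with
  | zero =>
    obtain ⟨i, hi⟩ := Finset.card_pos.1 hk
    refine boundsUpTo_zero ⟨b i, by simp, fun j hj => ?_⟩
    rw [b.inner_eq_ite, if_neg]
    rintro rfl
    exact hj hi
  | succ k ih =>
    obtain ⟨i, hi⟩ := Finset.card_pos.1 (k.succ_pos.trans hk)
    have := (ih (s.erase i) (by rw [Finset.card_erase_of_mem hi]; omega)).coordSubspace_insert b
      (Finset.notMem_erase i s)
    rwa [Finset.insert_erase hi] at this

/-- The small cycles of top dimension on the sphere are unique up to scalars and boundaries. -/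
lemma boundsUpTo_unitSphere_card {ι : Type*} [Fintype ι] (b : OrthonormalBasis ι ℝ W)
    (s : Finset ι) :
    BoundsUpTo R (unitSphere (coordSubspace b s)) (unitSphere (coordSubspace b s)) s.card 1 := by
  classical
  induction s using Finset.induction_on with
  | empty => exact boundsUpTo_zero_one _
  | insert i s hi ih =>
    rw [Finset.card_insert_of_notMem hi]
    exact ih.coordSubspace_insert b hi

lemma unitSphere_coordSubspace_univ {ι : Type*} [Fintype ι] (b : OrthonormalBasis ι ℝ W) :
    unitSphere (coordSubspace b Finset.univ) = Metric.sphere 0 1 :=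
  Set.inter_eq_left.2 fun _ _ i hi => absurd (Finset.mem_univ i) hi

/-- Transfer of the bounding property from a subset to the corresponding type. -/
lemma BoundsUpTo.subtype {α : Type*} [PseudoMetricSpace α] {A : Set α} {k d : ℕ}
    (hA : A.Nonempty) (h : BoundsUpTo R A A k d) :
    BoundsUpTo R (Set.univ : Set A) Set.univ k d := by
  classical
  obtain ⟨e, he⟩ := hA
  set r : α → A := fun x => if hx : x ∈ A then ⟨x, hx⟩ else ⟨e, he⟩ with hr
  have hrA : ∀ x ∈ A, (r x : α) = x := fun x hx => by simp [hr, hx]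
  intro ε hε
  obtain ⟨δ, hδ, H⟩ := h ε hε
  refine ⟨δ, hδ, fun z hz hz0 => ?_⟩
  obtain ⟨a, ha, w, hw, hwz⟩ := H (fun i => push Subtype.val (z i))
    (fun i => push_mem (A := Set.univ) (f := ((↑) : A → α)) (fun x _ => x.2)
      (fun x _ y _ hxy => hxy) (hz i))
    fun i => by rw [bdry_push, hz0, map_zero]
  refine ⟨a, ha, push r w, push_mem (fun x _ => Set.mem_univ _) (fun x hx y hy hxy => ?_) hw, ?_⟩
  · rwa [Subtype.dist_eq, hrA x hx, hrA y hy]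
  · have hid : r ∘ Subtype.val = id := funext fun x => Subtype.ext (hrA x x.2)
    simp only [bdry_push, hwz, map_sum, map_smul, push_push, hid, push_id]

end Sphere

section Cochains

variable {R : Type*} [Field R] {α : Type*}

/-- Evaluation of a cochain on chains. -/
noncomputable def eval (g : List α → R) : (List α →₀ R) →ₗ[R] R := Finsupp.linearCombination R g

/-- The coboundary of a cochain. -/
noncomputable def coboundary (g : List α → R) (l : List α) : R := eval g (faceSum l)

@[simp] lemma eval_single (g : List α → R) (l : List α) (r : R) :
    eval g (Finsupp.single l r) = r * g l := by
  simp [eval]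

lemma eval_bdry (g : List α → R) (c : List α →₀ R) :
    eval g (bdry c) = eval (coboundary g) c := by
  suffices (eval g).comp bdry = eval (coboundary g) from LinearMap.congr_fun this c
  ext l
  simp [coboundary]

lemma eval_push (g : List α → R) (f : α → α) (c : List α →₀ R) :
    eval g (push f c) = eval (fun l => g (l.map f)) c := by
  suffices (eval g).comp (push f) = eval (fun l => g (l.map f)) from LinearMap.congr_fun this c
  ext l
  simp

/-- The cup product with a function of three points. -/
def cupOne (w : α → α → α → R) (g : List α → R) : List α → R
  | a :: b :: c :: l => w a b c * g (c :: l)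
  | _ => 0

/-- The cup product of a list of functions of three points with a cochain. -/
def cup (ws : List (α → α → α → R)) (g : List α → R) : List α → R := ws.foldr cupOne g

lemma cup_cons (w : α → α → α → R) (ws : List (α → α → α → R)) (g : List α → R) :
    cup (w :: ws) g = cupOne w (cup ws g) := rfl

lemma cup_append (ws ws' : List (α → α → α → R)) (g : List α → R) :
    cup (ws ++ ws') g = cup ws (cup ws' g) := List.foldr_append

lemma eval_cupOne_cone (w : α → α → α → R) (g : List α → R) (a b c : α) (x : List α →₀ R) :
    eval (cupOne w g) (cone a (cone b (cone c x))) = w a b c * eval g (cone c x) := by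
  suffices (eval (cupOne w g)).comp ((cone a).comp ((cone b).comp (cone c))) =
      w a b c • (eval g).comp (cone c) from LinearMap.congr_fun this x
  ext l
  simp [cupOne]

lemma coboundary_cupOne {w : α → α → α → R}
    (hw : ∀ a b c d, w b c d - w a c d + w a b d = w a b c) {g : List α → R} (hg : g [] = 0) :
    coboundary (cupOne w g) = cupOne w (coboundary g) := by
  funext l
  match l with
  | [] => simp [coboundary, faceSum, cupOne]
  | [a] => simp [coboundary, faceSum, cupOne]
  | [a, b] => simp [coboundary, faceSum, cupOne]
  | [a, b, c] => simp [coboundary, faceSum, cupOne, hg]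
  | a :: b :: c :: d :: l =>
    have h1 : (faceSum (a :: b :: c :: d :: l) : List α →₀ R) =
        Finsupp.single (b :: c :: d :: l) 1 - Finsupp.single (a :: c :: d :: l) 1 +
          Finsupp.single (a :: b :: d :: l) 1 -
          cone a (cone b (cone c (faceSum (d :: l)))) := by
      rw [faceSum, faceSum, faceSum]
      simp only [map_sub, cone_single]
      abel
    rw [coboundary, h1, map_sub, map_add, map_sub, eval_cupOne_cone, cupOne, coboundary,
      faceSum.eq_2 c, map_sub]
    simp only [eval_single, cupOne, one_mul]
    rw [← hw a b c d]
    ring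

lemma coboundary_cup {ws : List (α → α → α → R)}
    (hw : ∀ w ∈ ws, ∀ a b c d, w b c d - w a c d + w a b d = w a b c) {g : List α → R}
    (hg : g [] = 0) : coboundary (cup ws g) = cup ws (coboundary g) := by
  induction ws with
  | nil => rfl
  | cons w ws ih =>
    have h0 : cup ws g [] = 0 := by
      cases ws with
      | nil => exact hg
      | cons => rfl
    rw [cup_cons, coboundary_cupOne (hw w (by simp)) h0, ih fun v hv => hw v (by simp [hv])]
    rfl

lemma cup_congr {g g' : List α → R} {k : ℕ} (h : ∀ l : List α, l.length = k → g l = g' l)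
    (ws : List (α → α → α → R)) {l : List α} (hl : l.length = 2 * ws.length + k) :
    cup ws g l = cup ws g' l := by
  induction ws generalizing l with
  | nil => exact h l (by simpa using hl)
  | cons w ws ih =>
    match l with
    | [] => rfl
    | [_] => rfl
    | [_, _] => rfl
    | a :: b :: c :: l =>
      rw [cup_cons, cup_cons, cupOne, cupOne, ih]
      simp only [List.length_cons] at hl ⊢
      omega

lemma cup_map {ws : List (α → α → α → R)} {f : α → α}
    (hf : ∀ w ∈ ws, ∀ a b c, w (f a) (f b) (f c) = w a b c) (g : List α → R) (l : List α) :
    cup ws g (l.map f) = cup ws (fun l => g (l.map f)) l := by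
  induction ws generalizing l with
  | nil => rfl
  | cons w ws ih =>
    match l with
    | [] => rfl
    | [_] => rfl
    | [_, _] => rfl
    | a :: b :: c :: l =>
      have := ih (fun v hv => hf v (by simp [hv])) (c :: l)
      rw [List.map_cons] at this
      simp only [List.map_cons, cup_cons, cupOne, hf w (by simp), this]

lemma cup_sub (ws : List (α → α → α → R)) (g g' : List α → R) (l : List α) :
    cup ws (fun l => g l - g' l) l = cup ws g l - cup ws g' l := by
  induction ws generalizing l with
  | nil => rfl
  | cons w ws ih =>
    match l with
    | [] => simp [cup_cons, cupOne]
    | [_] => simp [cup_cons, cupOne]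
    | [_, _] => simp [cup_cons, cupOne]
    | a :: b :: c :: l => simp [cup_cons, cupOne, ih, mul_sub]

lemma cup_sum {σ : Type*} (s : Finset σ) (ws : List (α → α → α → R)) (g : σ → List α → R)
    (l : List α) : cup ws (fun l => ∑ i ∈ s, g i l) l = ∑ i ∈ s, cup ws (g i) l := by
  induction ws generalizing l with
  | nil => rfl
  | cons w ws ih =>
    match l with
    | [] => simp [cup_cons, cupOne]
    | [_] => simp [cup_cons, cupOne]
    | [_, _] => simp [cup_cons, cupOne]
    | a :: b :: c :: l => simp [cup_cons, cupOne, ih, Finset.mul_sum]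

lemma cup_eq_zero {ws : List (α → α → α → R)} {w : α → α → α → R} (hws : w ∈ ws)
    (g : List α → R) {l : List α}
    (h : ∀ a ∈ l, ∀ b ∈ l, ∀ c ∈ l, w a b c = 0) : cup ws g l = 0 := by
  induction ws generalizing l with
  | nil => simp at hws
  | cons v ws ih =>
    match l with
    | [] => rfl
    | [_] => rfl
    | [_, _] => rfl
    | a :: b :: c :: l =>
      rw [cup_cons, cupOne]
      rcases List.mem_cons.1 hws with rfl | hws
      · rw [h a (by simp) b (by simp) c (by simp), zero_mul]
      · rw [ih hws, mul_zero]
        intro x hx y hy z hz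
        exact h x (by grind) y (by grind) z (by grind)

end Cochains

section Angle

variable {α : Type*} (p : ℕ)

/-- The number of turns from `a` to `b`, for an angle function `x` with values modulo `p`. -/
noncomputable def turns (x : α → ℝ) (a b : α) : ℤ := round ((x a - x b) / p)

/-- The coboundary of `turns`, modulo `p`. -/
noncomputable def turnClass (x : α → ℝ) (a b c : α) : ZMod p :=
  ((turns p x b c - turns p x a c + turns p x a b : ℤ) : ZMod p)

/-- The cochain of degree one given by `turns`. -/
noncomputable def turnCochain (x : α → ℝ) : List α → ZMod p
  | [a, b] => (turns p x a b : ZMod p)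
  | _ => 0

/-- The cochain of degree zero given by the sector containing a point. -/
noncomputable def sectorCochain (x : α → ℝ) : List α → ZMod p
  | [a] => (⌊x a⌋ : ZMod p)
  | _ => 0

/-- The cochain of degree zero with constant value one. -/
def oneCochain : List α → ZMod p
  | [_] => 1
  | _ => 0

/-- The cup product of the first `j` turn classes of a sequence of angle functions with a
cochain. -/
noncomputable def turnCup (x : ℕ → α → ℝ) (j : ℕ) (g : List α → ZMod p) [Fact p.Prime] :
    List α → ZMod p :=
  cup ((List.range j).map fun i => turnClass p (x i)) g

variable {p}

lemma turnClass_cocycle (x : α → ℝ) (a b c d : α) :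
    turnClass p x b c d - turnClass p x a c d + turnClass p x a b d = turnClass p x a b c := by
  simp only [turnClass]
  push_cast
  ring

lemma sum_wraps {f : ℤ} (h0 : 0 ≤ f) (h1 : f < p) :
    ∑ i ∈ Finset.range p, (if (p : ℤ) ≤ f + i then 1 else 0 : ℤ) = f := by
  lift f to ℕ using h0
  rw [Finset.sum_boole]
  have : {i ∈ Finset.range p | ((p : ℕ) : ℤ) ≤ f + (i : ℕ)} = Finset.Ico (p - f) p := by
    ext i
    simp only [Finset.mem_filter, Finset.mem_range, Finset.mem_Ico]
    omega
  rw [this, Nat.card_Ico]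
  omega

section Prime

variable [hp : Fact p.Prime]

lemma coboundary_turnCup (j : ℕ) {g : List α → ZMod p} (hg : g [] = 0) :
    coboundary (turnCup p x j g) = turnCup p x j (coboundary g) := by
  refine coboundary_cup (fun w hw a b c d => ?_) hg
  obtain ⟨k, -, rfl⟩ := List.mem_map.1 hw
  exact turnClass_cocycle (x k) a b c d

lemma turnCup_congr (j : ℕ) {g g' : List α → ZMod p} {k : ℕ}
    (h : ∀ l : List α, l.length = k → g l = g' l) {l : List α} (hl : l.length = 2 * j + k) :
    turnCup p x j g l = turnCup p x j g' l :=
  cup_congr h _ (by simpa using hl)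

lemma coboundary_turnCochain (y : α → ℝ) {l : List α} (hl : l.length = 3) :
    coboundary (turnCochain p y) l = cupOne (turnClass p y) (oneCochain p) l := by
  obtain ⟨a, b, c, rfl⟩ := List.length_eq_three.1 hl
  simp only [coboundary, faceSum, map_zero, sub_zero, map_sub, cone_single, eval_single,
    turnCochain, cupOne, oneCochain, turnClass]
  push_cast
  ring

lemma coboundary_turnCup_turnCochain (j : ℕ) {l : List α} (hl : l.length = 2 * j + 3) :
    coboundary (turnCup p x j (turnCochain p (x j))) l =
      turnCup p x (j + 1) (oneCochain p) l := by
  rw [coboundary_turnCup j rfl, turnCup_congr j (fun l => coboundary_turnCochain (x j)) hl,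
    turnCup, turnCup, List.range_succ, List.map_append, cup_append]
  rfl

lemma turns_eq_of_shift {y : α → ℝ} {a b a' b' : α} {r : ℝ} {m n : ℤ}
    (ha : y a' = y a + r - p * m) (hb : y b' = y b + r - p * n) :
    turns p y a' b' = turns p y a b - m + n := by
  have hp0 : (p : ℝ) ≠ 0 := by exact_mod_cast hp.out.ne_zero
  rw [turns, turns, ha, hb, show (y a + r - p * m - (y b + r - p * n)) / p =
    (y a - y b) / p + ((n - m : ℤ) : ℝ) by push_cast; field_simp; ring, round_add_intCast]
  ring

lemma coboundary_sectorCochain (y : α → ℝ) (a b : α) :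
    coboundary (sectorCochain p y) [a, b] = (⌊y b⌋ : ZMod p) - ⌊y a⌋ := by
  simp [coboundary, faceSum, sectorCochain]

end Prime

/-- Angle functions that are shifted by `t` and fixed by `s`, such that close points have close
angles for one of the first `N` functions. -/
structure IsAngleSystem [PseudoMetricSpace α] (p N : ℕ) (t s : α → α) (x : ℕ → α → ℝ) :
    Prop where
  nonneg : ∀ j a, 0 ≤ x j a
  lt : ∀ j a, x j a < p
  shift : ∀ j a, ∃ m : ℤ, x j (t a) = x j a + 1 - p * m
  fixed : ∀ j a, x j (s a) = x j a
  close : ∃ ε > 0, ∀ a, ∃ j < N, ∀ b c, dist a b < ε → dist a c < ε →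
    |(x j b - x j c) / p - turns p (x j) b c| < 1 / 3

namespace IsAngleSystem

variable [PseudoMetricSpace α] {N : ℕ} {t s : α → α} {x : ℕ → α → ℝ}

lemma exists_iterate (h : IsAngleSystem p N t s x) (j : ℕ) (a : α) (i : ℕ) :
    ∃ m : ℤ, x j (t^[i] a) = x j a + i - p * m := by
  induction i with
  | zero => exact ⟨0, by simp⟩
  | succ i ih =>
    obtain ⟨m, hm⟩ := ih
    obtain ⟨m', hm'⟩ := h.shift j (t^[i] a)
    refine ⟨m + m', ?_⟩
    rw [Function.iterate_succ_apply', hm', hm]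
    push_cast
    ring

variable [hp : Fact p.Prime]

lemma iterate_eq (h : IsAngleSystem p N t s x) (j : ℕ) (a : α) {i : ℕ} (hi : i < p) :
    x j (t^[i] a) = x j a + i - p * ((if (p : ℤ) ≤ ⌊x j a⌋ + i then 1 else 0 : ℤ) : ℝ) := by
  obtain ⟨m, hm⟩ := h.exists_iterate j a i
  have hp0 : (0 : ℝ) < p := by exact_mod_cast hp.out.pos
  have hi' : (i : ℝ) < p := by exact_mod_cast hi
  have h1 := h.nonneg j (t^[i] a)
  have h2 := h.lt j (t^[i] a)
  have h3 := h.nonneg j a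
  have h4 := h.lt j a
  rw [hm] at h1 h2 ⊢
  have hm0 : (-1 : ℝ) < m := by
    by_contra! hc
    nlinarith
  have hm2 : (m : ℝ) < 2 := by
    by_contra! hc
    nlinarith
  have hm0' : -1 < m := by exact_mod_cast hm0
  have hm2' : m < 2 := by exact_mod_cast hm2
  obtain rfl | rfl : m = 0 ∨ m = 1 := by omega
  · rw [if_neg]
    rw [not_le, ← Int.floor_add_natCast, Int.floor_lt]
    push_cast at h2 ⊢
    linarith
  · rw [if_pos]
    rw [← Int.floor_add_natCast, Int.le_floor]
    push_cast at h1 ⊢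
    linarith

lemma turnClass_shift (h : IsAngleSystem p N t s x) (j : ℕ) (a b c : α) :
    turnClass p (x j) (t a) (t b) (t c) = turnClass p (x j) a b c := by
  obtain ⟨m, hm⟩ := h.shift j a
  obtain ⟨n, hn⟩ := h.shift j b
  obtain ⟨k, hk⟩ := h.shift j c
  simp only [turnClass, turns_eq_of_shift hm hn, turns_eq_of_shift hn hk, turns_eq_of_shift hm hk]
  push_cast
  ring

lemma turnClass_iterate (h : IsAngleSystem p N t s x) (j i : ℕ) (a b c : α) :
    turnClass p (x j) (t^[i] a) (t^[i] b) (t^[i] c) = turnClass p (x j) a b c := by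
  induction i with
  | zero => rfl
  | succ i ih =>
    rw [Function.iterate_succ_apply', Function.iterate_succ_apply', Function.iterate_succ_apply',
      h.turnClass_shift, ih]

lemma turnCup_shift (h : IsAngleSystem p N t s x) (j : ℕ) (i : ℕ) (g : List α → ZMod p)
    (l : List α) : turnCup p x j g (l.map t^[i]) = turnCup p x j (fun l => g (l.map t^[i])) l := by
  refine cup_map (fun w hw a b c => ?_) g l
  obtain ⟨k, -, rfl⟩ := List.mem_map.1 hw
  exact h.turnClass_iterate k i a b c

lemma sectorCochain_shift (h : IsAngleSystem p N t s x) (j : ℕ) (l : List α) :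
    sectorCochain p (x j) (l.map t) - sectorCochain p (x j) l = oneCochain p l := by
  match l with
  | [] => simp [sectorCochain, oneCochain]
  | [a] =>
    obtain ⟨m, hm⟩ := h.shift j a
    have : x j a + 1 - p * m = x j a + ((1 - p * m : ℤ) : ℝ) := by push_cast; ring
    simp only [List.map_cons, List.map_nil, sectorCochain, oneCochain, hm, this,
      Int.floor_add_intCast]
    push_cast
    simp
  | a :: b :: l => simp [sectorCochain, oneCochain]

lemma sum_turnCochain_shift (h : IsAngleSystem p N t s x) (j : ℕ) {l : List α}
    (hl : l.length = 2) :
    ∑ i ∈ Finset.range p, turnCochain p (x j) (l.map t^[i]) =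
      coboundary (sectorCochain p (x j)) l := by
  obtain ⟨a, b, rfl⟩ := List.length_eq_two.1 hl
  have key : ∀ c, 0 ≤ ⌊x j c⌋ ∧ ⌊x j c⌋ < p := fun c =>
    ⟨Int.floor_nonneg.2 (h.nonneg j c), Int.floor_lt.2 (by simpa using h.lt j c)⟩
  rw [coboundary_sectorCochain]
  simp only [List.map_cons, List.map_nil, turnCochain]
  rw [← Int.cast_sum, Finset.sum_congr rfl fun i hi => turns_eq_of_shift
    (h.iterate_eq j a (Finset.mem_range.1 hi)) (h.iterate_eq j b (Finset.mem_range.1 hi)),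
    Finset.sum_add_distrib, Finset.sum_sub_distrib, sum_wraps (key a).1 (key a).2,
    sum_wraps (key b).1 (key b).2]
  simp
  ring

lemma turnCup_one_eq_zero (h : IsAngleSystem p N t s x) :
    ∃ ε > 0, ∀ A : Set α, ∀ k, ∀ l ∈ smallTuples A ε (k + 1),
      turnCup p x N (oneCochain p) l = 0 := by
  obtain ⟨ε, hε, H⟩ := h.close
  refine ⟨ε, hε, fun A k l hl => ?_⟩
  obtain ⟨a₀, ha₀⟩ := List.exists_mem_of_length_pos (by rw [hl.1]; omega : 0 < l.length)
  obtain ⟨j, hj, hclose⟩ := H a₀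
  refine cup_eq_zero (List.mem_map.2 ⟨j, List.mem_range.2 hj, rfl⟩) _ fun a ha b hb c hc => ?_
  have d := fun b hb => hl.2.2 a₀ ha₀ b hb
  have h1 := abs_lt.1 (hclose a b (d a ha) (d b hb))
  have h2 := abs_lt.1 (hclose b c (d b hb) (d c hc))
  have h3 := abs_lt.1 (hclose a c (d a ha) (d c hc))
  rw [turnClass]
  set z : ℤ := turns p (x j) b c - turns p (x j) a c + turns p (x j) a b with hz
  have hzr : (z : ℝ) = turns p (x j) b c - turns p (x j) a c + turns p (x j) a b := by
    rw [hz]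
    push_cast
    ring
  have hsum : (x j a - x j c) / p = (x j a - x j b) / p + (x j b - x j c) / p := by ring
  have hz1 : (z : ℝ) < 1 := by
    rw [hzr]
    linarith
  have hz2 : (-1 : ℝ) < z := by
    rw [hzr]
    linarith
  have hz1' : z < 1 := by exact_mod_cast hz1
  have hz2' : -1 < z := by exact_mod_cast hz2
  rw [show z = 0 by omega, Int.cast_zero]

lemma turnCup_turnCochain_fixed (h : IsAngleSystem p N t s x) (j i : ℕ) (l : List α) :
    turnCup p x j (turnCochain p (x j)) (l.map s^[i]) =
      turnCup p x j (turnCochain p (x j)) l := by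
  have hs : ∀ k a, x k (s^[i] a) = x k a := by
    intro k a
    induction i with
    | zero => rfl
    | succ i ih => rw [Function.iterate_succ_apply', h.fixed, ih]
  rw [turnCup, cup_map]
  · congr 1
    funext l
    match l with
    | [] => rfl
    | [_] => rfl
    | [a, b] => simp [turnCochain, turns, hs]
    | _ :: _ :: _ :: _ => rfl
  · intro w hw a b c
    obtain ⟨k, -, rfl⟩ := List.mem_map.1 hw
    simp [turnClass, turns, hs]

end IsAngleSystem

/-- The sum of the images of a chain under the first `p` iterates of a map. -/
noncomputable def orbitSum (p : ℕ) [Fact p.Prime] (t : α → α) :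
    (List α →₀ ZMod p) →ₗ[ZMod p] (List α →₀ ZMod p) :=
  ∑ i ∈ Finset.range p, push t^[i]

lemma orbitSum_apply [Fact p.Prime] (t : α → α) (c : List α →₀ ZMod p) :
    orbitSum p t c = ∑ i ∈ Finset.range p, push t^[i] c := by
  simp [orbitSum]

lemma bdry_orbitSum [Fact p.Prime] (t : α → α) (c : List α →₀ ZMod p) :
    bdry (orbitSum p t c) = orbitSum p t (bdry c) := by
  simp [orbitSum_apply, bdry_push]

lemma push_orbitSum [Fact p.Prime] {t : α → α} (ht : t^[p] = id) (c : List α →₀ ZMod p) :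
    push t (orbitSum p t c) = orbitSum p t c := by
  have := Finset.sum_range_succ' (fun i => push (R := ZMod p) t^[i] c) p
  rw [Finset.sum_range_succ, ht, Function.iterate_zero] at this
  rw [orbitSum_apply, map_sum, add_right_cancel this]
  exact Finset.sum_congr rfl fun i _ => by rw [push_push, ← Function.iterate_succ']

lemma orbitSum_push [Fact p.Prime] {t : α → α} (ht : t^[p] = id) (c : List α →₀ ZMod p) :
    orbitSum p t (push t c) = orbitSum p t c := by
  conv_rhs => rw [← push_orbitSum ht]
  rw [orbitSum_apply, orbitSum_apply, map_sum]
  refine Finset.sum_congr rfl fun i _ => ?_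
  rw [push_push, push_push, ← Function.iterate_succ, ← Function.iterate_succ']

lemma exists_orbitSum_mem [PseudoMetricSpace α] [Fact p.Prime] {t : α → α}
    (ht : UniformContinuous t) {ε : ℝ} (hε : 0 < ε) :
    ∃ δ > 0, δ ≤ ε ∧ ∀ k, ∀ c ∈ smallChains (ZMod p) Set.univ δ k,
      orbitSum p t c ∈ smallChains (ZMod p) Set.univ ε k ∧
        push t c ∈ smallChains (ZMod p) Set.univ ε k := by
  have hu : ∀ i : ℕ, UniformContinuous t^[i] := fun i => by
    induction i with
    | zero => exact uniformContinuous_id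
    | succ i ih => exact ih.comp ht
  choose δ hδ H using fun i => Metric.uniformContinuous_iff.1 (hu i) ε hε
  have hne : (Finset.range (p + 2)).Nonempty := ⟨0, by simp⟩
  refine ⟨min ε ((Finset.range (p + 2)).inf' hne δ), lt_min hε
    ((Finset.lt_inf'_iff hne).2 fun i _ => hδ i), min_le_left _ _, fun k c hc => ?_⟩
  have key : ∀ i ∈ Finset.range (p + 2), push t^[i] c ∈ smallChains (ZMod p) Set.univ ε k :=
    fun i hi => push_mem (fun _ _ => Set.mem_univ _)
      (fun a _ b _ hab => H i (hab.trans_le ((min_le_right _ _).trans (Finset.inf'_le _ hi)))) hc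
  refine ⟨?_, key 1 (by simp)⟩
  rw [orbitSum_apply]
  exact Submodule.sum_mem _ fun i hi => key i (by simp at hi ⊢; omega)

namespace IsAngleSystem

variable [PseudoMetricSpace α] {N : ℕ} {t s : α → α} {x : ℕ → α → ℝ} [hp : Fact p.Prime]

lemma eval_turnCup_sub (h : IsAngleSystem p N t s x) (j : ℕ) (c : List α →₀ ZMod p) :
    eval (turnCup p x j (sectorCochain p (x j))) (push t c - c) =
      eval (turnCup p x j (oneCochain p)) c := by
  rw [map_sub, eval_push, ← LinearMap.sub_apply]
  congr 1
  ext l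
  have := h.turnCup_shift j 1 (sectorCochain p (x j)) l
  simp only [Function.iterate_one] at this
  simp only [LinearMap.comp_apply, LinearMap.sub_apply, Finsupp.lsingle_apply, eval_single, this,
    one_mul]
  rw [turnCup, turnCup, turnCup, ← cup_sub]
  simp only [h.sectorCochain_shift]

lemma eval_turnCup_orbitSum (h : IsAngleSystem p N t s x) (j : ℕ) {A : Set α} {ε : ℝ}
    {c : List α →₀ ZMod p} (hc : c ∈ smallChains (ZMod p) A ε (2 * j + 2)) :
    eval (turnCup p x j (turnCochain p (x j))) (orbitSum p t c) =
      eval (turnCup p x j (coboundary (sectorCochain p (x j)))) c := by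
  refine map_congr_of_mem (f := (eval _).comp (orbitSum p t)) (fun l hl => ?_) hc
  simp only [LinearMap.comp_apply, orbitSum_apply, map_sum, push_single, eval_single, one_mul,
    h.turnCup_shift]
  rw [← turnCup_congr j (fun l => h.sum_turnCochain_shift j) hl.1]
  exact (cup_sum _ _ _ _).symm

lemma eval_turnCup_orbitSum_fixed (h : IsAngleSystem p N t s x) (j : ℕ) (c : List α →₀ ZMod p) :
    eval (turnCup p x j (turnCochain p (x j))) (orbitSum p s c) = 0 := by
  rw [orbitSum_apply, map_sum]
  simp only [eval_push, h.turnCup_turnCochain_fixed]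
  simp

lemma exists_chain_even_odd (h : IsAngleSystem p N t s x) (ht : UniformContinuous t)
    (htp : t^[p] = id) {j : ℕ}
    (hb : BoundsUpTo (ZMod p) (Set.univ : Set α) Set.univ (2 * j + 1) 0)
    (H : ∀ ε > 0, ∃ c ∈ smallChains (ZMod p) (Set.univ : Set α) ε (2 * j + 1),
      bdry (push t c - c) = 0 ∧ eval (turnCup p x j (oneCochain p)) c = 1)
    {ε : ℝ} (hε : 0 < ε) :
    ∃ c ∈ smallChains (ZMod p) (Set.univ : Set α) ε (2 * j + 2),
      bdry (orbitSum p t c) = 0 ∧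
        eval (turnCup p x j (coboundary (sectorCochain p (x j)))) c = 1 := by
  obtain ⟨δ, hδ, h1⟩ := hb.exists_bdry_eq hε
  obtain ⟨δ', hδ', hle, h2⟩ := exists_orbitSum_mem (p := p) ht hδ
  obtain ⟨c, hc, hc0, hc1⟩ := H δ' hδ'
  obtain ⟨w, hw, hwc⟩ := h1 (push t c - c) (Submodule.sub_mem _ (h2 _ c hc).2
    (smallChains_mono subset_rfl hle _ hc)) hc0
  refine ⟨w, hw, ?_, ?_⟩
  · rw [bdry_orbitSum, hwc, map_sub, orbitSum_push htp, sub_self]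
  · rw [← coboundary_turnCup j rfl, ← eval_bdry, hwc, h.eval_turnCup_sub, hc1]

lemma exists_chain_odd_even (h : IsAngleSystem p N t s x) (ht : UniformContinuous t)
    (htp : t^[p] = id) {j : ℕ}
    (hb : BoundsUpTo (ZMod p) (Set.univ : Set α) Set.univ (2 * j + 2) 0)
    (H : ∀ ε > 0, ∃ c ∈ smallChains (ZMod p) (Set.univ : Set α) ε (2 * j + 2),
      bdry (orbitSum p t c) = 0 ∧
        eval (turnCup p x j (coboundary (sectorCochain p (x j)))) c = 1)
    {ε : ℝ} (hε : 0 < ε) :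
    ∃ c ∈ smallChains (ZMod p) (Set.univ : Set α) ε (2 * (j + 1) + 1),
      bdry (push t c - c) = 0 ∧ eval (turnCup p x (j + 1) (oneCochain p)) c = 1 := by
  obtain ⟨δ, hδ, h1⟩ := hb.exists_bdry_eq hε
  obtain ⟨δ', hδ', hle, h2⟩ := exists_orbitSum_mem (p := p) ht hδ
  obtain ⟨c, hc, hc0, hc1⟩ := H δ' hδ'
  obtain ⟨w, hw, hwc⟩ := h1 (orbitSum p t c) (h2 _ c hc).1 hc0
  refine ⟨w, hw, ?_, ?_⟩
  · rw [map_sub, bdry_push, hwc, push_orbitSum htp, sub_self]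
  · rw [← hc1, ← h.eval_turnCup_orbitSum j hc, ← hwc, eval_bdry]
    refine map_congr_of_mem (fun l hl => ?_) hw
    rw [eval_single, eval_single, coboundary_turnCup_turnCochain j hl.1]

lemma exists_chain (h : IsAngleSystem p N t s x) (ht : UniformContinuous t)
    (htp : t^[p] = id) [Nonempty α] {j : ℕ}
    (hb : ∀ k < 2 * j + 2, BoundsUpTo (ZMod p) (Set.univ : Set α) Set.univ k 0)
    {ε : ℝ} (hε : 0 < ε) :
    ∃ c ∈ smallChains (ZMod p) (Set.univ : Set α) ε (2 * j + 2),
      bdry (orbitSum p t c) = 0 ∧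
        eval (turnCup p x j (coboundary (sectorCochain p (x j)))) c = 1 := by
  induction j generalizing ε with
  | zero =>
    refine h.exists_chain_even_odd ht htp (hb 1 (by omega)) (fun ε hε => ?_) hε
    let a : α := Classical.arbitrary α
    refine ⟨Finsupp.single [a] 1, single_mem ⟨rfl, by simp, by simpa using hε⟩ _, ?_, ?_⟩
    · simp [faceSum]
    · simp [turnCup, cup, oneCochain]
  | succ j ih =>
    refine h.exists_chain_even_odd ht htp (hb _ (by omega)) (fun ε hε => ?_) hε
    exact h.exists_chain_odd_even ht htp (hb _ (by omega))
      (fun ε hε => ih (fun k hk => hb k (by omega)) hε) hε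

/-- A space with the small cycles of a `(2 * N + 1)`-dimensional sphere does not carry angle
systems for two different actions of the cyclic group of order `p`. -/
lemma not_isAngleSystem_swap (h : IsAngleSystem p (N + 1) t s x) {x' : ℕ → α → ℝ} [Nonempty α]
    (ht : UniformContinuous t) (htp : t^[p] = id) (hs : UniformContinuous s) (hsp : s^[p] = id)
    (hb : ∀ k < 2 * N + 2, BoundsUpTo (ZMod p) (Set.univ : Set α) Set.univ k 0)
    (htop : BoundsUpTo (ZMod p) (Set.univ : Set α) Set.univ (2 * N + 2) 1) :
    ¬ IsAngleSystem p (N + 1) s t x' := by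
  intro h'
  obtain ⟨ε, hε, hvan⟩ := h.turnCup_one_eq_zero
  obtain ⟨ε', hε', hvan'⟩ := h'.turnCup_one_eq_zero
  obtain ⟨δ, hδ, H⟩ := htop (min ε ε') (lt_min hε hε')
  obtain ⟨δ₁, hδ₁, -, h₁⟩ := exists_orbitSum_mem (p := p) ht hδ
  obtain ⟨δ₂, hδ₂, -, h₂⟩ := exists_orbitSum_mem (p := p) hs hδ
  obtain ⟨c, hc, hc0, hc1⟩ := h.exists_chain ht htp hb hδ₁
  obtain ⟨d, hd, hd0, hd1⟩ := h'.exists_chain hs hsp hb hδ₂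
  obtain ⟨a, ha, w, hw, hwz⟩ := H ![orbitSum p t c, orbitSum p s d]
    (Fin.forall_fin_two.2 ⟨(h₁ _ c hc).1, (h₂ _ d hd).1⟩) (Fin.forall_fin_two.2 ⟨hc0, hd0⟩)
  rw [Fin.sum_univ_two] at hwz
  change bdry w = a 0 • orbitSum p t c + a 1 • orbitSum p s d at hwz
  have vanish : ∀ {t s : α → α} {x : ℕ → α → ℝ} {ε : ℝ}, IsAngleSystem p (N + 1) t s x →
      w ∈ smallChains (ZMod p) Set.univ ε (2 * N + 2 + 1) →
      (∀ A : Set α, ∀ k, ∀ l ∈ smallTuples A ε (k + 1),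
        turnCup p x (N + 1) (oneCochain p) l = 0) →
      eval (turnCup p x N (turnCochain p (x N))) (bdry w) = 0 := by
    intro t s x ε _ hw hvan
    rw [eval_bdry]
    refine map_congr_of_mem (g := 0) (fun l hl => ?_) hw
    rw [eval_single, coboundary_turnCup_turnCochain N hl.1, hvan _ _ l hl, mul_zero,
      LinearMap.zero_apply]
  have v₁ := vanish h (smallChains_mono subset_rfl (min_le_left _ _) _ hw) hvan
  have v₂ := vanish h' (smallChains_mono subset_rfl (min_le_right _ _) _ hw) hvan'
  rw [hwz, map_add, map_smul, map_smul, h.eval_turnCup_orbitSum_fixed,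
    h.eval_turnCup_orbitSum N hc, hc1] at v₁
  rw [hwz, map_add, map_smul, map_smul, h'.eval_turnCup_orbitSum_fixed,
    h'.eval_turnCup_orbitSum N hd, hd1] at v₂
  refine ha (funext (Fin.forall_fin_two.2 ⟨?_, ?_⟩))
  · simpa using v₁
  · simpa using v₂

end IsAngleSystem

end Angle

end SmallChain

section Equivariant

lemma exists_ne_zero_near {W : Type*} [NormedAddCommGroup W] [NormedSpace ℝ W]
    [FiniteDimensional ℝ W] {N : ℕ} (hW : Module.finrank ℝ W = 2 * N)
    (F : C(Metric.sphere (0 : W) 1, Fin N → ℂ)) {ε : ℝ} (hε : 0 < ε) :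
    ∃ F' : C(Metric.sphere (0 : W) 1, Fin N → ℂ), (∀ y, F' y ≠ 0) ∧ ∀ y, ‖F' y - F y‖ < ε := by
  let e : (Fin N → ℂ) ≃L[ℝ] W := ContinuousLinearEquiv.ofFinrankEq <| by
    rw [Module.finrank_pi_fintype, hW]
    simp [mul_comm]
  obtain ⟨G, hG⟩ := ContinuousMap.exists_restrict_eq Metric.isClosed_sphere F
  obtain ⟨Q, hQ, hQG, -⟩ := G.continuous.exists_contDiff_approx 1
    (continuous_const (y := ε / 2)) fun _ => half_pos hε
  borelize W
  have hnull : (MeasureTheory.Measure.addHaar : MeasureTheory.Measure W)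
      ((e ∘ Q) '' Metric.sphere (0 : W) 1) = 0 :=
    MeasureTheory.addHaar_image_eq_zero_of_differentiableOn_of_addHaar_eq_zero _
      (e.differentiable.comp (hQ.differentiable one_ne_zero)).differentiableOn
      (MeasureTheory.Measure.addHaar_sphere_of_ne_zero _ _ one_ne_zero)
  have hopen : IsOpen (e.symm ⁻¹' Metric.ball (0 : Fin N → ℂ) (ε / 2)) :=
    Metric.isOpen_ball.preimage e.symm.continuous
  have hpos := hopen.measure_pos (MeasureTheory.Measure.addHaar : MeasureTheory.Measure W)
    ⟨0, by simpa using hε⟩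
  obtain ⟨v, hv, hvn⟩ : ∃ v ∈ e.symm ⁻¹' Metric.ball (0 : Fin N → ℂ) (ε / 2),
      v ∉ (e ∘ Q) '' Metric.sphere (0 : W) 1 := by
    by_contra! hc
    exact hpos.ne' (MeasureTheory.measure_mono_null hc hnull)
  refine ⟨⟨fun y => Q y - e.symm v, by
    exact (hQ.continuous.comp continuous_subtype_val).sub continuous_const⟩, fun y hy => ?_,
    fun y => ?_⟩
  · refine hvn ⟨y, y.2, ?_⟩
    have : Q y = e.symm v := sub_eq_zero.1 hy
    simp [this]
  · have h1 := hQG y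
    have h2 : G y = F y := by rw [← hG]; rfl
    rw [dist_eq_norm, h2] at h1
    have h3 : ‖e.symm v‖ < ε / 2 := by simpa using hv
    calc ‖Q y - e.symm v - F y‖ = ‖(Q y - F y) - e.symm v‖ := by congr 1; abel
      _ ≤ ‖Q y - F y‖ + ‖e.symm v‖ := norm_sub_le _ _
      _ < ε := by linarith

variable {Y E V : Type*} [MetricSpace Y] [Group E] [Finite E] [MulAction E Y]
  [ContinuousConstSMul E Y] [NormedAddCommGroup V] [NormedSpace ℂ V]

lemma exists_equivariant_insert (χ : E →* ℂ) (hχ : ∀ g, ‖χ g‖ = 1)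
    (happ : ∀ F : C(Y, V), ∀ ε > 0, ∃ F' : C(Y, V), (∀ y, F' y ≠ 0) ∧ ∀ y, ‖F' y - F y‖ < ε)
    {η : ℝ} (hη : 0 < η) (hfree : ∀ g : E, g ≠ 1 → ∀ y : Y, 3 * η ≤ dist y (g • y))
    {K : Set Y} (hK : IsCompact K) (F : C(Y, V)) (hF : ∀ (g : E) y, F (g • y) = χ g • F y)
    (hFK : ∀ y ∈ K, F y ≠ 0) (y₀ : Y) :
    ∃ F' : C(Y, V), (∀ (g : E) y, F' (g • y) = χ g • F' y) ∧
      ∀ y ∈ K ∪ Metric.closedBall y₀ (η / 2), F' y ≠ 0 := by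
  have := Fintype.ofFinite E
  obtain ⟨m, hm, hmK⟩ : ∃ m > 0, ∀ y ∈ K, m ≤ ‖F y‖ := by
    rcases K.eq_empty_or_nonempty with rfl | hne
    · exact ⟨1, one_pos, by simp⟩
    · obtain ⟨z, hz, hmin⟩ := hK.exists_isMinOn hne F.continuous.norm.continuousOn
      exact ⟨‖F z‖, norm_pos_iff.2 (hFK z hz), fun y hy => hmin hy⟩
  have hcard : (0 : ℝ) < Fintype.card E := by exact_mod_cast Fintype.card_pos
  obtain ⟨F₁, hF₁, hnear⟩ := happ F (m / Fintype.card E) (div_pos hm hcard)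
  let ψ : Y → ℝ := fun y => max 0 (min 1 (2 - 2 * dist y y₀ / η))
  have hψc : Continuous ψ := by fun_prop
  have hψ0 : ∀ y, 0 ≤ ψ y := fun y => le_max_left _ _
  have hψ1 : ∀ y, ψ y ≤ 1 := fun y => max_le zero_le_one (min_le_left _ _)
  have hψ_one : ∀ y, dist y y₀ ≤ η / 2 → ψ y = 1 := by
    intro y hy
    have : 2 * dist y y₀ / η ≤ 1 := by rw [div_le_one hη]; linarith
    simp only [ψ]
    rw [min_eq_left (by linarith), max_eq_right zero_le_one]
  have hψ_zero : ∀ y, η ≤ dist y y₀ → ψ y = 0 := by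
    intro y hy
    have : 2 ≤ 2 * dist y y₀ / η := by rw [le_div_iff₀ hη]; linarith
    simp only [ψ]
    exact max_eq_left ((min_le_right _ _).trans (by linarith))
  let D : E → Y → V := fun g y =>
    χ g • ((ψ (g⁻¹ • y) : ℂ) • (F₁ (g⁻¹ • y) - F (g⁻¹ • y)))
  have hD : ∀ g, Continuous (D g) := by
    intro g
    have := continuous_const_smul (T := Y) g⁻¹
    have h1 := F₁.continuous.comp this
    have h2 := F.continuous.comp this
    exact ((Complex.continuous_ofReal.comp (hψc.comp this)).smul (h1.sub h2)).const_smul _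
  have hDn : ∀ g y, ‖D g y‖ < m / Fintype.card E := by
    intro g y
    simp only [D]
    rw [norm_smul, hχ, one_mul, norm_smul, Complex.norm_real, Real.norm_eq_abs,
      abs_of_nonneg (hψ0 _)]
    exact (mul_le_of_le_one_left (norm_nonneg _) (hψ1 _)).trans_lt (hnear _)
  refine ⟨⟨fun y => F y + ∑ g, D g y, F.continuous.add (continuous_finsetSum _ fun g _ => hD g)⟩,
    fun h y => ?_, fun y hy => ?_⟩
  · simp only [ContinuousMap.coe_mk]
    rw [hF, smul_add, Finset.smul_sum, ← Equiv.sum_comp (Equiv.mulLeft h)]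
    congr 1
    refine Finset.sum_congr rfl fun g _ => ?_
    simp only [D, Equiv.coe_mulLeft, mul_inv_rev, smul_smul, map_mul, inv_mul_cancel_right]
    simp only [mul_assoc]
  · simp only [ContinuousMap.coe_mk]
    rcases hy with hy | hy
    · intro h0
      have h1 : ‖∑ g, D g y‖ < m := by
        calc ‖∑ g, D g y‖ ≤ ∑ g, ‖D g y‖ := norm_sum_le _ _
          _ < ∑ _g : E, m / Fintype.card E :=
            Finset.sum_lt_sum_of_nonempty Finset.univ_nonempty fun g _ => hDn g y
          _ = m := by
            rw [Finset.sum_const, nsmul_eq_mul, Finset.card_univ]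
            field_simp
      have h2 := hmK y hy
      rw [eq_neg_of_add_eq_zero_left h0, norm_neg] at h2
      linarith
    · rw [Metric.mem_closedBall] at hy
      rw [Finset.sum_eq_single 1 (fun g _ hg => ?_) (by simp)]
      · simp only [D, map_one, inv_one, one_smul, hψ_one y hy, Complex.ofReal_one]
        rw [add_sub_cancel]
        exact hF₁ y
      · have h1 := hfree g⁻¹ (by simpa using hg) y
        have h2 := dist_triangle y y₀ (g⁻¹ • y)
        rw [dist_comm y₀] at h2
        simp [D, hψ_zero (g⁻¹ • y) (by linarith)]

variable [CompactSpace Y]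

lemma exists_le_dist_smul (hfree : ∀ (g : E) (y : Y), g • y = y → g = 1) :
    ∃ η > 0, ∀ g : E, g ≠ 1 → ∀ y : Y, η ≤ dist y (g • y) := by
  have key : ∀ g : E, ∃ η > 0, g ≠ 1 → ∀ y : Y, η ≤ dist y (g • y) := by
    intro g
    by_cases hg : g = 1
    · exact ⟨1, one_pos, fun h => (h hg).elim⟩
    rcases isEmpty_or_nonempty Y with hY | hY
    · exact ⟨1, one_pos, fun _ y => hY.elim y⟩
    obtain ⟨y₀, -, hy₀⟩ := (isCompact_univ (X := Y)).exists_isMinOn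
      Set.univ_nonempty (continuous_id.dist (continuous_const_smul g)).continuousOn
    exact ⟨dist y₀ (g • y₀), dist_pos.2 fun h => hg (hfree g y₀ h.symm),
      fun _ y => hy₀ (Set.mem_univ y)⟩
  choose η hη H using key
  have := Fintype.ofFinite E
  have hne : (Finset.univ : Finset E).Nonempty := Finset.univ_nonempty
  exact ⟨Finset.univ.inf' hne η, (Finset.lt_inf'_iff hne).2 fun g _ => hη g,
    fun g hg y => (Finset.inf'_le η (Finset.mem_univ g)).trans (H g hg y)⟩

/-- If continuous functions on a compact space can be approximated by nowhere vanishing ones, then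
there is a nowhere vanishing function which transforms by a given character of a free action. -/
lemma exists_equivariant_ne_zero (hfree : ∀ (g : E) (y : Y), g • y = y → g = 1)
    (χ : E →* ℂ) (hχ : ∀ g, ‖χ g‖ = 1)
    (happ : ∀ F : C(Y, V), ∀ ε > 0, ∃ F' : C(Y, V), (∀ y, F' y ≠ 0) ∧ ∀ y, ‖F' y - F y‖ < ε) :
    ∃ F : C(Y, V), (∀ (g : E) y, F (g • y) = χ g • F y) ∧ ∀ y, F y ≠ 0 := by
  classical
  obtain ⟨η₀, hη₀, hfar⟩ := exists_le_dist_smul hfree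
  obtain ⟨η, hη, rfl⟩ : ∃ η > 0, η₀ = 3 * η := ⟨η₀ / 3, by positivity, by ring⟩
  have key : ∀ T : Finset Y, ∃ F : C(Y, V), (∀ (g : E) y, F (g • y) = χ g • F y) ∧
      ∀ y ∈ ⋃ z ∈ T, Metric.closedBall z (η / 2), F y ≠ 0 := by
    intro T
    induction T using Finset.induction_on with
    | empty => exact ⟨0, by simp, by simp⟩
    | insert z T _ ih =>
      obtain ⟨F, hF, hFT⟩ := ih
      obtain ⟨F', hF', hFT'⟩ := exists_equivariant_insert χ hχ happ hη hfar
        (T.isCompact_biUnion fun z _ => (Metric.isClosed_closedBall (x := z)).isCompact) F hF hFT z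
      refine ⟨F', hF', fun y hy => hFT' y ?_⟩
      rwa [Finset.set_biUnion_insert, Set.union_comm] at hy
  obtain ⟨T, -, hT⟩ := (isCompact_univ (X := Y)).elim_nhds_subcover
    (fun z => Metric.closedBall z (η / 2)) fun z _ => Metric.closedBall_mem_nhds z (half_pos hη)
  obtain ⟨F, hF, hFT⟩ := key T
  exact ⟨F, hF, fun y => hFT y (hT (Set.mem_univ y))⟩

end Equivariant

section AngleSystem

lemma exists_int_arg_div_sub {z w : ℂ} (hz : z ≠ 0) (hw : w ≠ 0) :
    ∃ k : ℤ, z.arg / (2 * Real.pi) - w.arg / (2 * Real.pi) =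
      (z / w).arg / (2 * Real.pi) + k := by
  have h : ((z.arg - w.arg : ℝ) : Real.Angle) = ((z / w).arg : ℝ) := by
    rw [Complex.arg_div_coe_angle hz hw, Real.Angle.coe_sub]
  obtain ⟨k, hk⟩ := Real.Angle.angle_eq_iff_two_pi_dvd_sub.1 h
  refine ⟨k, ?_⟩
  have := Real.pi_pos
  rw [← sub_div, eq_add_of_sub_eq' hk]
  field_simp

lemma exists_angle_coordinate {N : ℕ} {c : ℝ} (hc : 0 < c) (j : Fin N) :
    ∃ f : (Fin N → ℂ) → ℂ, (∀ v, c ≤ ‖v j‖ → f v = v j) ∧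
      (∀ v, (∃ i, c ≤ ‖v i‖) → f v ≠ 0) ∧ ∀ ω : ℂ, ‖ω‖ = 1 → ∀ v, f (ω • v) = ω * f v := by
  classical
  let sel : (Fin N → ℝ) → Fin N := fun u =>
    if c ≤ u j then j else if h : ∃ i, c ≤ u i then h.choose else j
  refine ⟨fun v => v (sel fun i => ‖v i‖), fun v hv => ?_, fun v hv => ?_, fun ω hω v => ?_⟩
  · simp [sel, hv]
  · have : c ≤ ‖v (sel fun i => ‖v i‖)‖ := by
      by_cases hj : c ≤ ‖v j‖
      · simp [sel, hj]
      · have := hv.choose_spec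
        simpa [sel, hj, hv] using this
    exact norm_pos_iff.1 (hc.trans_le this)
  · simp [hω]

lemma SmallChain.exists_isAngleSystem {Y : Type*} [PseudoMetricSpace Y] [CompactSpace Y]
    {p N : ℕ} [NeZero p] [NeZero N] {t s : Y → Y} {F : Y → Fin N → ℂ} (hF : Continuous F)
    (hF0 : ∀ y, F y ≠ 0) {ω : ℂ} (hω : ‖ω‖ = 1)
    (harg : ∃ k : ℤ, ω.arg / (2 * Real.pi) = 1 / p + k)
    (ht : ∀ y, F (t y) = ω • F y) (hs : ∀ y, F (s y) = F y) :
    ∃ x, SmallChain.IsAngleSystem p N t s x := by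
  obtain ⟨c, hc, hcF⟩ : ∃ c > 0, ∀ y, ∃ i, 2 * c ≤ ‖F y i‖ := by
    rcases isEmpty_or_nonempty Y with hY | hY
    · exact ⟨1, one_pos, fun y => hY.elim y⟩
    obtain ⟨z, -, hz⟩ := isCompact_univ.exists_isMinOn Set.univ_nonempty
      (hF.norm.continuousOn (s := Set.univ))
    refine ⟨‖F z‖ / 2, half_pos (norm_pos_iff.2 (hF0 z)), fun y => ?_⟩
    by_contra! hlt
    have h1 : ‖F y‖ < ‖F z‖ := (pi_norm_lt_iff (norm_pos_iff.2 (hF0 z))).2 fun i => by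
      have := hlt i
      linarith
    exact h1.not_ge (hz (Set.mem_univ y))
  choose f hfj hf0 hfω using fun j : Fin N => exists_angle_coordinate hc j
  have hZ0 : ∀ j y, f j (F y) ≠ 0 := fun j y =>
    hf0 j _ ((hcF y).imp fun i hi => by linarith)
  have hp0 : (0 : ℝ) < p := by exact_mod_cast NeZero.pos p
  refine ⟨fun j y => p * Int.fract ((f (Fin.ofNat N j) (F y)).arg / (2 * Real.pi)), ?_, ?_, ?_, ?_,
    ?_⟩
  · exact fun j y => mul_nonneg hp0.le (Int.fract_nonneg _)
  · exact fun j y => mul_lt_of_lt_one_right hp0 (Int.fract_lt_one _)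
  · intro j y
    set z := f (Fin.ofNat N j) (F y)
    have hz : z ≠ 0 := hZ0 _ y
    have hω0 : ω ≠ 0 := norm_pos_iff.1 (by rw [hω]; exact one_pos)
    obtain ⟨k, hk⟩ := exists_int_arg_div_sub (mul_ne_zero hω0 hz) hz
    rw [mul_div_cancel_right₀ _ hz] at hk
    obtain ⟨l, hl⟩ := harg
    refine ⟨⌊(ω * z).arg / (2 * Real.pi)⌋ - ⌊z.arg / (2 * Real.pi)⌋ - k - l, ?_⟩
    rw [ht, hfω _ _ hω]
    simp only [Int.fract]
    have h2 : (ω * z).arg / (2 * Real.pi) = z.arg / (2 * Real.pi) + 1 / p + l + k := by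
      linarith
    have h3 : (p : ℝ) * (1 / p) = 1 := by field_simp
    push_cast
    linear_combination (p : ℝ) * h2 + h3
  · intro j y
    rw [hs]
  · obtain ⟨ε, hε, hu⟩ := Metric.uniformContinuous_iff.1
      (CompactSpace.uniformContinuous_of_continuous hF) (c / 2) (half_pos hc)
    refine ⟨ε, hε, fun a => ?_⟩
    obtain ⟨i, hi⟩ := hcF a
    refine ⟨i, i.2, fun b d hb hd => ?_⟩
    have near : ∀ b, dist a b < ε → ‖F a i - F b i‖ < c / 2 := fun b hb =>
      ((norm_le_pi_norm (F a - F b) i).trans_eq (dist_eq_norm _ _).symm).trans_lt (hu hb)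
    have big : ∀ b, dist a b < ε → c < ‖F b i‖ := fun b hb => by
      have h1 := near b hb
      have h2 := norm_sub_norm_le (F a i) (F b i)
      linarith
    have hbi := hfj i (F b) (big b hb).le
    have hdi := hfj i (F d) (big d hd).le
    have hb0 : F b i ≠ 0 := norm_pos_iff.1 (hc.trans (big b hb))
    have hd0 : F d i ≠ 0 := norm_pos_iff.1 (hc.trans (big d hd))
    have hquot : |(F b i / F d i).arg| < Real.pi / 2 := by
      rw [Complex.abs_arg_lt_pi_div_two_iff]
      left
      have h1 : ‖F b i / F d i - 1‖ < 1 := by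
        rw [div_sub_one hd0, norm_div, div_lt_one (norm_pos_iff.2 hd0)]
        calc ‖F b i - F d i‖ = ‖(F a i - F d i) - (F a i - F b i)‖ := by congr 1; ring
          _ ≤ ‖F a i - F d i‖ + ‖F a i - F b i‖ := norm_sub_le _ _
          _ < ‖F d i‖ := by linarith [near b hb, near d hd, big d hd]
      have h2 := (abs_lt.1 ((Complex.abs_re_le_norm _).trans_lt h1)).1
      rw [Complex.sub_re, Complex.one_re] at h2
      linarith
    obtain ⟨k, hk⟩ := exists_int_arg_div_sub hb0 hd0
    have hfin : Fin.ofNat N (i : ℕ) = i := by simp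
    rw [SmallChain.turns]
    simp only [hfin, hbi, hdi]
    rw [← mul_sub, mul_div_cancel_left₀ _ hp0.ne']
    refine (round_le _ (k - ⌊(F b i).arg / (2 * Real.pi)⌋ + ⌊(F d i).arg / (2 * Real.pi)⌋)).trans_lt
      ?_
    simp only [Int.fract]
    push_cast
    have h4 : |(F b i / F d i).arg / (2 * Real.pi)| < 1 / 3 := by
      rw [abs_div, abs_of_pos Real.two_pi_pos, div_lt_iff₀ Real.two_pi_pos]
      linarith [Real.pi_pos]
    refine lt_of_eq_of_lt (congrArg abs ?_) h4
    linear_combination hk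

end AngleSystem

section ElementaryAbelian

lemma zmod_stdAddChar_norm {p : ℕ} [NeZero p] (i : ZMod p) : ‖ZMod.stdAddChar i‖ = 1 := by
  rw [ZMod.stdAddChar_apply, Circle.norm_coe]

lemma exists_int_arg_stdAddChar_one {p : ℕ} [NeZero p] :
    ∃ k : ℤ, (ZMod.stdAddChar (1 : ZMod p)).arg / (2 * Real.pi) = 1 / p + k := by
  have h : (((ZMod.stdAddChar (1 : ZMod p)).arg : ℝ) : Real.Angle) =
      (2 * Real.pi * (1 / p) : ℝ) := by
    have h1 := ZMod.stdAddChar_coe (N := p) 1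
    rw [show 2 * (Real.pi : ℂ) * Complex.I * ((1 : ℤ) : ℂ) / p =
      ((2 * Real.pi * (1 / p) : ℝ) : ℂ) * Complex.I by push_cast; ring, Int.cast_one] at h1
    rw [h1, Complex.exp_mul_I]
    simpa using Complex.arg_cos_add_sin_mul_I_coe_angle ((2 * Real.pi * (1 / p) : ℝ) : Real.Angle)
  obtain ⟨k, hk⟩ := Real.Angle.angle_eq_iff_two_pi_dvd_sub.1 h
  refine ⟨k, ?_⟩
  have := Real.pi_pos
  rw [eq_add_of_sub_eq' hk]
  field_simp

open SmallChain

/-- The group `(ℤ/p)²` does not act freely on a sphere of odd dimension. -/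
lemma not_free_zmod_prod_of_finrank_eq {W : Type*} [NormedAddCommGroup W] [InnerProductSpace ℝ W]
    [FiniteDimensional ℝ W] {N : ℕ} (hW : Module.finrank ℝ W = 2 * (N + 1)) {p : ℕ}
    [Fact p.Prime] [MulAction (Multiplicative (ZMod p) × Multiplicative (ZMod p))
      (Metric.sphere (0 : W) 1)]
    [ContinuousConstSMul (Multiplicative (ZMod p) × Multiplicative (ZMod p))
      (Metric.sphere (0 : W) 1)] :
    ¬ ∀ (g : Multiplicative (ZMod p) × Multiplicative (ZMod p)) (y : Metric.sphere (0 : W) 1),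
      g • y = y → g = 1 := by
  intro hfree
  have hnt : Nontrivial W := Module.nontrivial_of_finrank_pos (R := ℝ) (by omega)
  have hne : (Metric.sphere (0 : W) 1).Nonempty := NormedSpace.sphere_nonempty.2 zero_le_one
  have : Nonempty (Metric.sphere (0 : W) 1) := hne.to_subtype
  let χ : Multiplicative (ZMod p) →* ℂ := (ZMod.stdAddChar (N := p)).toMonoidHom
  have hχ : ∀ g, ‖χ g‖ = 1 := fun g => zmod_stdAddChar_norm g.toAdd
  let τ : Multiplicative (ZMod p) := Multiplicative.ofAdd 1
  have hτp : τ ^ p = 1 := by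
    rw [← ofAdd_nsmul]
    simp
  obtain ⟨F, hF, hF0⟩ := exists_equivariant_ne_zero hfree (χ.comp (MonoidHom.fst _ _))
    (fun g => hχ g.1) fun F ε hε => exists_ne_zero_near hW F hε
  obtain ⟨G, hG, hG0⟩ := exists_equivariant_ne_zero hfree (χ.comp (MonoidHom.snd _ _))
    (fun g => hχ g.2) fun F ε hε => exists_ne_zero_near hW F hε
  obtain ⟨x, hx⟩ := exists_isAngleSystem (p := p)
    (t := fun y => (τ, (1 : Multiplicative (ZMod p))) • y)
    (s := fun y => ((1 : Multiplicative (ZMod p)), τ) • y) F.continuous hF0 (hχ τ)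
    exists_int_arg_stdAddChar_one (fun y => hF _ y) fun y => by rw [hF]; simp
  obtain ⟨x', hx'⟩ := exists_isAngleSystem (p := p)
    (t := fun y => ((1 : Multiplicative (ZMod p)), τ) • y)
    (s := fun y => (τ, (1 : Multiplicative (ZMod p))) • y) G.continuous hG0 (hχ τ)
    exists_int_arg_stdAddChar_one (fun y => hG _ y) fun y => by rw [hG]; simp
  let b := stdOrthonormalBasis ℝ W
  have hcard : (Finset.univ : Finset (Fin (Module.finrank ℝ W))).card = 2 * N + 2 := by
    rw [Finset.card_univ, Fintype.card_fin, hW]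
    ring
  refine hx.not_isAngleSystem_swap ?_ ?_ ?_ ?_ (fun k hk => ?_) ?_ hx'
  · exact CompactSpace.uniformContinuous_of_continuous (continuous_const_smul _)
  · rw [smul_iterate, Prod.pow_mk, hτp, one_pow]
    funext y
    exact one_smul _ y
  · exact CompactSpace.uniformContinuous_of_continuous (continuous_const_smul _)
  · rw [smul_iterate, Prod.pow_mk, hτp, one_pow]
    funext y
    exact one_smul _ y
  · have := boundsUpTo_unitSphere_of_lt (R := ZMod p) b k Finset.univ (by omega)
    rw [unitSphere_coordSubspace_univ] at this
    exact this.subtype hne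
  · have := boundsUpTo_unitSphere_card (R := ZMod p) b Finset.univ
    rw [unitSphere_coordSubspace_univ, hcard] at this
    exact this.subtype hne

end ElementaryAbelian

section Radial

variable {W : Type*} [NormedAddCommGroup W] [NormedSpace ℝ W]

/-- The radial extension of a self-map of the unit sphere. -/
noncomputable def radial (f : Metric.sphere (0 : W) 1 → Metric.sphere (0 : W) 1) (v : W) : W :=
  ‖v‖ • Function.extend Subtype.val (Subtype.val ∘ f) 0 (‖v‖⁻¹ • v)

lemma radial_zero (f : Metric.sphere (0 : W) 1 → Metric.sphere (0 : W) 1) : radial f 0 = 0 := by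
  simp [radial]

lemma radial_smul (f : Metric.sphere (0 : W) 1 → Metric.sphere (0 : W) 1) {r : ℝ} (hr : 0 < r)
    (u : Metric.sphere (0 : W) 1) : radial f (r • (u : W)) = r • (f u : W) := by
  have hu : ‖(u : W)‖ = 1 := by simp
  rw [radial, norm_smul, hu, mul_one, Real.norm_of_nonneg hr.le, inv_smul_smul₀ hr.ne',
    Subtype.val_injective.extend_apply]
  rfl

lemma exists_eq_smul_sphere {v : W} (hv : v ≠ 0) :
    ∃ u : Metric.sphere (0 : W) 1, v = ‖v‖ • (u : W) :=
  ⟨⟨‖v‖⁻¹ • v, by simp [norm_smul, hv]⟩, by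
    rw [smul_inv_smul₀ (norm_ne_zero_iff.2 hv)]⟩

lemma norm_radial (f : Metric.sphere (0 : W) 1 → Metric.sphere (0 : W) 1) (v : W) :
    ‖radial f v‖ = ‖v‖ := by
  by_cases hv : v = 0
  · rw [hv, radial_zero]
  obtain ⟨u, hu⟩ := exists_eq_smul_sphere hv
  rw [hu, radial_smul f (norm_pos_iff.2 hv), norm_smul, norm_smul]
  simp

lemma radial_id (v : W) : radial id v = v := by
  by_cases hv : v = 0
  · rw [hv, radial_zero]
  obtain ⟨u, hu⟩ := exists_eq_smul_sphere hv
  rw [hu, radial_smul _ (norm_pos_iff.2 hv), id]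

lemma radial_radial (f g : Metric.sphere (0 : W) 1 → Metric.sphere (0 : W) 1) (v : W) :
    radial f (radial g v) = radial (f ∘ g) v := by
  by_cases hv : v = 0
  · rw [hv, radial_zero, radial_zero, radial_zero]
  obtain ⟨u, hu⟩ := exists_eq_smul_sphere hv
  rw [hu, radial_smul _ (norm_pos_iff.2 hv), radial_smul _ (norm_pos_iff.2 hv),
    radial_smul _ (norm_pos_iff.2 hv), Function.comp_apply]

lemma exists_eq_of_radial_eq {f : Metric.sphere (0 : W) 1 → Metric.sphere (0 : W) 1} {v : W}
    (hv : v ≠ 0) (h : radial f v = v) : ∃ u, f u = u := by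
  obtain ⟨u, hu⟩ := exists_eq_smul_sphere hv
  rw [hu, radial_smul _ (norm_pos_iff.2 hv)] at h
  exact ⟨u, Subtype.ext (smul_right_injective W (norm_ne_zero_iff.2 hv) h)⟩

lemma continuous_radial {f : Metric.sphere (0 : W) 1 → Metric.sphere (0 : W) 1}
    (hf : Continuous f) : Continuous (radial f) := by
  have hext : ContinuousOn (Function.extend Subtype.val (Subtype.val ∘ f) (0 : W → W))
      (Metric.sphere (0 : W) 1) := by
    rw [continuousOn_iff_continuous_domRestrict]
    convert continuous_subtype_val.comp hf
    funext u
    exact Subtype.val_injective.extend_apply _ _ u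
  rw [continuous_iff_continuousAt]
  intro v
  by_cases hv : v = 0
  · subst hv
    rw [ContinuousAt, radial_zero]
    refine squeeze_zero_norm (fun w => (norm_radial f w).le) ?_
    simpa using (continuous_norm (E := W)).tendsto 0
  · have hon : ContinuousOn (radial f) {0}ᶜ := by
      refine continuous_norm.continuousOn.smul (hext.comp ?_ fun w hw => ?_)
      · exact (continuous_norm.continuousOn.inv₀ fun w hw => norm_ne_zero_iff.2 hw).smul
          continuousOn_id
      · have : w ≠ 0 := hw
        simp [norm_smul, this]
    exact hon.continuousAt (isOpen_compl_singleton.mem_nhds hv)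

end Radial

section Join

variable {W : Type*} [NormedAddCommGroup W] [InnerProductSpace ℝ W] {E : Type*} [Group E]

/-- The diagonal action on the unit sphere of `W × W` obtained by radial extension from an action
on the unit sphere of `W`. -/
@[reducible]
noncomputable def joinAction [MulAction E (Metric.sphere (0 : W) 1)] :
    MulAction E (Metric.sphere (0 : WithLp 2 (W × W)) 1) where
  smul g y := ⟨WithLp.toLp 2 (radial (g • ·) y.1.fst, radial (g • ·) y.1.snd), by
    have h := mem_sphere_zero_iff_norm.1 y.2
    rw [WithLp.prod_norm_eq_of_L2] at h
    rw [mem_sphere_zero_iff_norm, WithLp.prod_norm_eq_of_L2]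
    simpa only [WithLp.toLp_fst, WithLp.toLp_snd, norm_radial] using h⟩
  one_smul y := by
    have h : (fun y : Metric.sphere (0 : W) 1 => (1 : E) • y) = id := funext fun y => one_smul E y
    refine Subtype.ext (WithLp.ofLp_injective 2 (Prod.ext ?_ ?_))
    · exact (congrArg (radial · y.1.fst) h).trans (radial_id _)
    · exact (congrArg (radial · y.1.snd) h).trans (radial_id _)
  mul_smul g k y := by
    have h : (fun y : Metric.sphere (0 : W) 1 => (g * k) • y) = (g • ·) ∘ (k • ·) :=
      funext fun y => mul_smul g k y
    refine Subtype.ext (WithLp.ofLp_injective 2 (Prod.ext ?_ ?_))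
    · exact (congrArg (radial · y.1.fst) h).trans (radial_radial _ _ _).symm
    · exact (congrArg (radial · y.1.snd) h).trans (radial_radial _ _ _).symm

lemma continuous_joinAction [MulAction E (Metric.sphere (0 : W) 1)]
    [ContinuousConstSMul E (Metric.sphere (0 : W) 1)] (g : E) :
    Continuous fun y : Metric.sphere (0 : WithLp 2 (W × W)) 1 => joinAction.smul g y := by
  refine Continuous.subtype_mk ((WithLp.prod_continuous_toLp 2 W W).comp ?_) _
  have h := continuous_radial (continuous_const_smul (T := Metric.sphere (0 : W) 1) g)
  have hy := (WithLp.prod_continuous_ofLp 2 W W).comp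
    (continuous_subtype_val (p := (· ∈ Metric.sphere (0 : WithLp 2 (W × W)) 1)))
  exact (h.comp (continuous_fst.comp hy)).prodMk (h.comp (continuous_snd.comp hy))

lemma joinAction_free [MulAction E (Metric.sphere (0 : W) 1)]
    (hfree : ∀ (g : E) (y : Metric.sphere (0 : W) 1), g • y = y → g = 1) (g : E)
    (y : Metric.sphere (0 : WithLp 2 (W × W)) 1) (h : joinAction.smul g y = y) : g = 1 := by
  have h1 : radial (g • ·) y.1.fst = y.1.fst := congrArg (fun z => z.1.fst) h
  have h2 : radial (g • ·) y.1.snd = y.1.snd := congrArg (fun z => z.1.snd) h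
  by_cases hy1 : y.1.fst = 0
  · have hy2 : y.1.snd ≠ 0 := by
      intro hy2
      have := mem_sphere_zero_iff_norm.1 y.2
      rw [WithLp.prod_norm_eq_of_L2, hy1, hy2] at this
      simp at this
    obtain ⟨u, hu⟩ := exists_eq_of_radial_eq hy2 h2
    exact hfree g u hu
  · obtain ⟨u, hu⟩ := exists_eq_of_radial_eq hy1 h1
    exact hfree g u hu

/-- The group `(ℤ/p)²` does not act freely on a sphere. -/
lemma not_free_zmod_prod [FiniteDimensional ℝ W] [Nontrivial W] {p : ℕ} [Fact p.Prime]
    [MulAction (Multiplicative (ZMod p) × Multiplicative (ZMod p)) (Metric.sphere (0 : W) 1)]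
    [ContinuousConstSMul (Multiplicative (ZMod p) × Multiplicative (ZMod p))
      (Metric.sphere (0 : W) 1)] :
    ¬ ∀ (g : Multiplicative (ZMod p) × Multiplicative (ZMod p)) (y : Metric.sphere (0 : W) 1),
      g • y = y → g = 1 := by
  intro hfree
  obtain ⟨N, hN⟩ := Nat.exists_eq_add_one.2 (Module.finrank_pos (R := ℝ) (M := W))
  have hfin : Module.finrank ℝ (WithLp 2 (W × W)) = 2 * (N + 1) := by
    rw [(WithLp.linearEquiv 2 ℝ (W × W)).finrank_eq, Module.finrank_prod, hN]
    ring
  let _ := joinAction (W := W) (E := Multiplicative (ZMod p) × Multiplicative (ZMod p))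
  have : ContinuousConstSMul (Multiplicative (ZMod p) × Multiplicative (ZMod p))
    (Metric.sphere (0 : WithLp 2 (W × W)) 1) := ⟨continuous_joinAction⟩
  exact not_free_zmod_prod_of_finrank_eq hfin (joinAction_free hfree)

end Join

section Group

variable {A : Type*} [CommGroup A] [Finite A]

lemma card_ker_powMonoidHom_le
    (h : ∀ p, p.Prime → Nat.card (powMonoidHom p : A →* A).ker ≤ p) {n : ℕ} (hn : n ≠ 0) :
    Nat.card (powMonoidHom n : A →* A).ker ≤ n := by
  induction n using induction_on_primes with
  | zero => exact absurd rfl hn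
  | one => simp [show (powMonoidHom 1 : A →* A).ker = ⊥ by ext; simp]
  | prime_mul p a hp ih =>
    have ha := ih (right_ne_zero_of_mul hn)
    let K := (powMonoidHom (p * a) : A →* A).ker
    let f : K →* A := (powMonoidHom a).comp K.subtype
    have hrange : f.range ≤ (powMonoidHom p : A →* A).ker := by
      rintro _ ⟨x, rfl⟩
      have hx : (x : A) ^ (p * a) = 1 := x.2
      simpa [f, MonoidHom.mem_ker, pow_mul'] using hx
    have hker : Nat.card f.ker ≤ Nat.card (powMonoidHom a : A →* A).ker :=
      Nat.card_le_card_of_injective (fun x => ⟨x.1.1, x.2⟩) fun x y hxy =>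
        Subtype.ext (Subtype.ext (congrArg (fun z => z.1) hxy))
    calc Nat.card K = Nat.card f.ker * Nat.card f.range := by
          rw [← Subgroup.index_ker, Subgroup.card_mul_index]
      _ ≤ a * p := Nat.mul_le_mul (hker.trans ha) ((Subgroup.card_le_of_le hrange).trans (h p hp))
      _ = p * a := mul_comm _ _

lemma isCyclic_of_card_ker_powMonoidHom_le
    (h : ∀ p, p.Prime → Nat.card (powMonoidHom p : A →* A).ker ≤ p) : IsCyclic A := by
  classical
  have := Fintype.ofFinite A
  refine isCyclic_of_card_pow_eq_one_le fun n hn => ?_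
  refine le_of_eq_of_le ?_ (card_ker_powMonoidHom_le h hn.ne')
  rw [← Fintype.card_subtype, ← Nat.card_eq_fintype_card]
  rfl

lemma exists_injective_linearMap_zmod_prod {p : ℕ} [Fact p.Prime] {V : Type*} [AddCommGroup V]
    [Module (ZMod p) V] [Finite V] (hV : p < Nat.card V) :
    ∃ L : ZMod p × ZMod p →ₗ[ZMod p] V, Function.Injective L := by
  rw [Module.natCard_eq_pow_finrank (K := ZMod p), Nat.card_zmod] at hV
  have hrank : 1 < Module.finrank (ZMod p) V :=
    (Nat.pow_lt_pow_iff_right (Fact.out : p.Prime).one_lt).1 (by rwa [pow_one])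
  have hnt : Nontrivial V := Module.nontrivial_of_finrank_pos (R := ZMod p) (by omega)
  obtain ⟨x, hx⟩ := exists_ne (0 : V)
  obtain ⟨y, hy⟩ := exists_linearIndependent_pair_of_one_lt_finrank hrank hx
  rw [LinearIndependent.pair_iff] at hy
  refine ⟨(LinearMap.toSpanSingleton (ZMod p) V x).coprod
    (LinearMap.toSpanSingleton (ZMod p) V y), (injective_iff_map_eq_zero _).2 fun v hv => ?_⟩
  obtain ⟨h1, h2⟩ := hy v.1 v.2 (by simpa using hv)
  exact Prod.ext h1 h2

lemma exists_injective_addMonoidHom_zmod_prod {p : ℕ} [Fact p.Prime] {V : Type*} [AddCommGroup V]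
    [Finite V] (hpV : ∀ x : V, p • x = 0) (hV : p < Nat.card V) :
    ∃ L : ZMod p × ZMod p →+ V, Function.Injective L := by
  let _ : Module (ZMod p) V := AddCommGroup.zmodModule hpV
  obtain ⟨L, hL⟩ := exists_injective_linearMap_zmod_prod (p := p) hV
  exact ⟨L.toAddMonoidHom, hL⟩

lemma exists_injective_zmod_prod (hA : ¬ IsCyclic A) :
    ∃ p, p.Prime ∧ ∃ f : Multiplicative (ZMod p) × Multiplicative (ZMod p) →* A,
      Function.Injective f := by
  obtain ⟨p, hp, hcard⟩ : ∃ p, p.Prime ∧ p < Nat.card (powMonoidHom p : A →* A).ker := by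
    by_contra! h
    exact hA (isCyclic_of_card_ker_powMonoidHom_le h)
  have := Fact.mk hp
  refine ⟨p, hp, ?_⟩
  obtain ⟨L, hL⟩ := exists_injective_addMonoidHom_zmod_prod (p := p)
    (V := Additive (powMonoidHom p : A →* A).ker)
    (fun x => Additive.toMul.injective (Subtype.ext x.toMul.2)) hcard
  let f : Multiplicative (ZMod p) × Multiplicative (ZMod p) →* A :=
    { toFun := fun g => (L (g.1.toAdd, g.2.toAdd)).toMul.1
      map_one' := congrArg (fun v : Additive (powMonoidHom p : A →* A).ker => v.toMul.1)
        (map_zero L)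
      map_mul' := fun g k => congrArg (fun v : Additive (powMonoidHom p : A →* A).ker => v.toMul.1)
        (map_add L (g.1.toAdd, g.2.toAdd) (k.1.toAdd, k.2.toAdd)) }
  refine ⟨f, fun g k hgk => ?_⟩
  have h := hL (Additive.toMul.injective (Subtype.ext hgk))
  exact Prod.ext (Multiplicative.toAdd.injective (congrArg Prod.fst h))
    (Multiplicative.toAdd.injective (congrArg Prod.snd h))

end Group

/-- **P. A. Smith's theorem (1944).** If a finite group `G` acts freely and continuously on
the sphere `S^n` for some `n ≥ 0`, then every abelian subgroup of `G` is cyclic. -/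
theorem smith_abelian_subgroups_cyclic_of_free_action_on_sphere
    (G : Type) [Group G] [Finite G] (n : ℕ)
    (φ : G →* (Sph n ≃ₜ Sph n))
    (hfree : ∀ (g : G) (x : Sph n), φ g x = x → g = 1)
    (A : Subgroup G) (hA : ∀ a b : A, a * b = b * a) :
    IsCyclic A := by
  by_contra hcyc
  let _ : CommGroup A := { (inferInstance : Group A) with mul_comm := hA }
  obtain ⟨p, hp, f, hf⟩ := exists_injective_zmod_prod (A := A) hcyc
  have := Fact.mk hp
  let ψ : Multiplicative (ZMod p) × Multiplicative (ZMod p) →* (Sph n ≃ₜ Sph n) :=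
    (φ.comp A.subtype).comp f
  let _ : MulAction (Multiplicative (ZMod p) × Multiplicative (ZMod p)) (Sph n) :=
    { smul := fun g y => ψ g y
      one_smul := fun y => congrArg (fun e : Sph n ≃ₜ Sph n => e y) (map_one ψ)
      mul_smul := fun g k y => congrArg (fun e : Sph n ≃ₜ Sph n => e y) (map_mul ψ g k) }
  have : ContinuousConstSMul (Multiplicative (ZMod p) × Multiplicative (ZMod p)) (Sph n) :=
    ⟨fun g => (ψ g).continuous⟩
  refine not_free_zmod_prod (W := EuclideanSpace ℝ (Fin (n + 1))) (p := p) fun g y hgy => hf ?_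
  rw [map_one]
  exact Subtype.ext (hfree _ y hgy)
end

section
/- If a finite group G acts freely and continuously on the sphere S^n for some n ≥ 0, then every element of order 2 in G is central, i.e., every g ∈ G with g² = 1 lies in the center of G. -/
open Metric

namespace SmallChains

open Filter Topology

/-! ### Ordered simplicial chains modulo two

A simplex is a list of vertices; the empty list is the augmentation simplex. -/

/-- Formal sums modulo two of lists of points. -/
abbrev Chain (X : Type*) := List X →₀ ZMod 2

section Algebra

variable {X Y Z : Type*}

/-- The chain consisting of a single simplex. -/
noncomputable abbrev simplex (l : List X) : Chain X := Finsupp.single l 1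

theorem linearMap_ext {M : Type*} [AddCommMonoid M] [Module (ZMod 2) M]
    {φ ψ : Chain X →ₗ[ZMod 2] M} (h : ∀ l, φ (simplex l) = ψ (simplex l)) : φ = ψ :=
  Finsupp.lhom_ext' fun l => LinearMap.ext_ring (h l)

/-- The cone with apex `x`. -/
noncomputable def cone (x : X) : Chain X →ₗ[ZMod 2] Chain X :=
  Finsupp.lmapDomain _ _ (List.cons x)

@[simp] theorem cone_simplex (x : X) (l : List X) : cone x (simplex l) = simplex (x :: l) := by
  simp [cone, Finsupp.lmapDomain_apply, Finsupp.mapDomain_single]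

/-- The boundary of a single simplex. -/
noncomputable def listBoundary : List X → Chain X
  | [] => 0
  | x :: l => simplex l + cone x (listBoundary l)

/-- The boundary operator of the augmented ordered chain complex. -/
noncomputable def boundary : Chain X →ₗ[ZMod 2] Chain X :=
  Finsupp.linearCombination (ZMod 2) listBoundary

@[simp] theorem boundary_simplex (l : List X) : boundary (simplex l) = listBoundary l := by
  simp [boundary]

theorem boundary_cone (x : X) (c : Chain X) : boundary (cone x c) = c + cone x (boundary c) := by
  have : boundary ∘ₗ cone x = LinearMap.id + cone x ∘ₗ boundary :=
    linearMap_ext fun l => by simp [listBoundary]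
  exact LinearMap.congr_fun this c

theorem boundary_boundary (c : Chain X) : boundary (boundary c) = 0 := by
  have : boundary ∘ₗ boundary = (0 : Chain X →ₗ[ZMod 2] Chain X) := by
    refine linearMap_ext fun l => ?_
    induction l with
    | nil => simp [listBoundary]
    | cons x l ih =>
      have ih' : boundary (listBoundary l) = 0 := by simpa using ih
      simp [listBoundary, boundary_cone, ih', ZModModule.add_self]
  exact LinearMap.congr_fun this c

/-- The chain map induced by a map of vertices. -/
noncomputable def push (f : X → Y) : Chain X →ₗ[ZMod 2] Chain Y :=
  Finsupp.lmapDomain _ _ (List.map f)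

@[simp] theorem push_simplex (f : X → Y) (l : List X) :
    push f (simplex l) = simplex (l.map f) := by
  simp [push, Finsupp.lmapDomain_apply, Finsupp.mapDomain_single]

theorem push_id (c : Chain X) : push id c = c := by
  have : push id = (LinearMap.id : Chain X →ₗ[ZMod 2] Chain X) :=
    linearMap_ext fun l => by simp
  exact LinearMap.congr_fun this c

theorem push_push (g : Y → Z) (f : X → Y) (c : Chain X) :
    push g (push f c) = push (g ∘ f) c := by
  have : push g ∘ₗ push f = push (g ∘ f) := linearMap_ext fun l => by simp
  exact LinearMap.congr_fun this c

theorem push_cone (f : X → Y) (x : X) (c : Chain X) :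
    push f (cone x c) = cone (f x) (push f c) := by
  have : push f ∘ₗ cone x = cone (f x) ∘ₗ push f := linearMap_ext fun l => by simp
  exact LinearMap.congr_fun this c

theorem boundary_push (f : X → Y) (c : Chain X) :
    boundary (push f c) = push f (boundary c) := by
  have : boundary ∘ₗ push f = push f ∘ₗ boundary := by
    refine linearMap_ext fun l => ?_
    induction l with
    | nil => simp [listBoundary]
    | cons x l ih =>
      have ih' : listBoundary (l.map f) = push f (listBoundary l) := by simpa using ih
      simp [listBoundary, push_cone, ih']
  exact LinearMap.congr_fun this c

/-- The triangulated prism over a single simplex. -/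
noncomputable def listPrism (f g : X → Y) : List X → Chain Y
  | [] => 0
  | x :: l => simplex (f x :: g x :: l.map g) + cone (f x) (listPrism f g l)

/-- The prism operator between the chain maps induced by `f` and `g`. -/
noncomputable def prism (f g : X → Y) : Chain X →ₗ[ZMod 2] Chain Y :=
  Finsupp.linearCombination (ZMod 2) (listPrism f g)

@[simp] theorem prism_simplex (f g : X → Y) (l : List X) :
    prism f g (simplex l) = listPrism f g l := by
  simp [prism]

theorem prism_cone (f g : X → Y) (x : X) (c : Chain X) :
    prism f g (cone x c) = cone (f x) (cone (g x) (push g c)) + cone (f x) (prism f g c) := by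
  have : prism f g ∘ₗ cone x =
      cone (f x) ∘ₗ cone (g x) ∘ₗ push g + cone (f x) ∘ₗ prism f g :=
    linearMap_ext fun l => by simp [listPrism]
  exact LinearMap.congr_fun this c

theorem boundary_prism_add (f g : X → Y) (c : Chain X) :
    boundary (prism f g c) + prism f g (boundary c) = push f c + push g c := by
  have : boundary ∘ₗ prism f g + prism f g ∘ₗ boundary = push f + push g := by
    refine linearMap_ext fun l => ?_
    induction l with
    | nil => simp [listPrism, listBoundary, ZModModule.add_self]
    | cons x l ih =>
      have ih' : boundary (listPrism f g l) + prism f g (listBoundary l) =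
          simplex (l.map f) + simplex (l.map g) := by simpa using ih
      have hb : listBoundary (l.map g) = push g (listBoundary l) := by
        simpa using boundary_push g (simplex l)
      have ih2 := congrArg (cone (f x)) ih'
      simp only [map_add, cone_simplex] at ih2
      simp only [LinearMap.add_apply, LinearMap.comp_apply, prism_simplex, listPrism, map_add,
        boundary_simplex, listBoundary, boundary_cone, prism_cone, hb, cone_simplex, push_simplex,
        List.map_cons]
      have e1 := ZModModule.add_self (listPrism f g l)
      have e2 := ZModModule.add_self (cone (f x) (cone (g x) (push g (listBoundary l))))
      have e3 := ZModModule.add_self (simplex (f x :: l.map g))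
      grind
  exact LinearMap.congr_fun this c

end Algebra

/-! ### Families of chains whose mesh tends to zero

Statements about the members of a family are required to hold along a fixed nonprincipal
ultrafilter, so that a family of elements of a finite set is eventually constant. -/

section Small

variable {X Y : Type*}

theorem map_mem_supported {φ : Chain X →ₗ[ZMod 2] Chain Y} {s : Set (List X)}
    {t : Set (List Y)}
    (h : ∀ l ∈ s, φ (simplex l) ∈ Finsupp.supported (ZMod 2) (ZMod 2) t) {c : Chain X}
    (hc : c ∈ Finsupp.supported (ZMod 2) (ZMod 2) s) :
    φ c ∈ Finsupp.supported (ZMod 2) (ZMod 2) t := by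
  rw [Finsupp.supported_eq_span_single] at hc
  have : Submodule.span (ZMod 2) ((fun i => Finsupp.single i (1 : ZMod 2)) '' s) ≤
      (Finsupp.supported (ZMod 2) (ZMod 2) t).comap φ := by
    rw [Submodule.span_le]
    rintro _ ⟨l, hl, rfl⟩
    exact h l hl
  exact this hc

theorem eqOn_supported {M : Type*} [AddCommMonoid M] [Module (ZMod 2) M]
    {φ ψ : Chain X →ₗ[ZMod 2] M} {s : Set (List X)}
    (h : ∀ l ∈ s, φ (simplex l) = ψ (simplex l)) {c : Chain X}
    (hc : c ∈ Finsupp.supported (ZMod 2) (ZMod 2) s) : φ c = ψ c := by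
  rw [Finsupp.supported_eq_span_single] at hc
  refine LinearMap.eqOn_span ?_ hc
  rintro _ ⟨l, hl, rfl⟩
  exact h l hl

theorem simplex_mem_supported {s : Set (List X)} {l : List X} (hl : l ∈ s) :
    simplex l ∈ Finsupp.supported (ZMod 2) (ZMod 2) s :=
  Finsupp.single_mem_supported _ _ hl

theorem listBoundary_mem_supported (l : List X) :
    listBoundary l ∈ Finsupp.supported (ZMod 2) (ZMod 2)
      {l' | l'.length + 1 = l.length ∧ ∀ x ∈ l', x ∈ l} := by
  induction l with
  | nil => exact Submodule.zero_mem _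
  | cons x l ih =>
    refine Submodule.add_mem _ (simplex_mem_supported ⟨rfl, fun y hy => by simp [hy]⟩) ?_
    refine map_mem_supported (fun l' hl' => ?_) ih
    rw [cone_simplex]
    refine simplex_mem_supported ⟨by simp [hl'.1], fun y hy => ?_⟩
    rcases List.mem_cons.1 hy with rfl | hy
    · simp
    · simp [hl'.2 y hy]

theorem listPrism_mem_supported (f g : X → Y) (l : List X) :
    listPrism f g l ∈ Finsupp.supported (ZMod 2) (ZMod 2)
      {l' | l'.length = l.length + 1 ∧ ∀ y ∈ l', ∃ x ∈ l, y = f x ∨ y = g x} := by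
  induction l with
  | nil => exact Submodule.zero_mem _
  | cons x l ih =>
    refine Submodule.add_mem _ (simplex_mem_supported ⟨by simp, fun y hy => ?_⟩) ?_
    · simp only [List.mem_cons, List.mem_map] at hy ⊢
      grind
    refine map_mem_supported (fun l' hl' => ?_) ih
    rw [cone_simplex]
    refine simplex_mem_supported ⟨by simp [hl'.1], fun y hy => ?_⟩
    rcases List.mem_cons.1 hy with rfl | hy
    · exact ⟨x, by simp⟩
    · obtain ⟨w, hw, h⟩ := hl'.2 y hy
      exact ⟨w, by simp [hw], h⟩

variable [PseudoMetricSpace X] [PseudoMetricSpace Y]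

/-- Lists of `k` points of `K` with pairwise distances less than `ε`. -/
def smallLists (K : Set X) (ε : ℝ) (k : ℕ) : Set (List X) :=
  {l | l.length = k ∧ (∀ x ∈ l, x ∈ K) ∧ ∀ x ∈ l, ∀ y ∈ l, dist x y < ε}

/-- Chains of simplices in `K` with `k` vertices and mesh less than `ε`. -/
noncomputable abbrev smallChains (K : Set X) (ε : ℝ) (k : ℕ) : Submodule (ZMod 2) (Chain X) :=
  Finsupp.supported (ZMod 2) (ZMod 2) (smallLists K ε k)

theorem smallLists_mono {K L : Set X} (h : K ⊆ L) (ε : ℝ) (k : ℕ) :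
    smallLists K ε k ⊆ smallLists L ε k :=
  fun _ hl => ⟨hl.1, fun x hx => h (hl.2.1 x hx), hl.2.2⟩

/-- A sequence of chains in `A` on simplices with `k` vertices, eventually supported in
a fixed compact set and with mesh tending to zero. -/
def Tame (A : Set X) (k : ℕ) (c : ℕ → Chain X) : Prop :=
  ∃ K ⊆ A, IsCompact K ∧ ∀ ε > 0, ∀ᶠ m in hyperfilter ℕ, c m ∈ smallChains K ε k

theorem Tame.add {A : Set X} {k : ℕ} {c d : ℕ → Chain X} (hc : Tame A k c) (hd : Tame A k d) :
    Tame A k (c + d) := by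
  obtain ⟨K, hKA, hK, hc⟩ := hc
  obtain ⟨L, hLA, hL, hd⟩ := hd
  refine ⟨K ∪ L, Set.union_subset hKA hLA, hK.union hL, fun ε hε => ?_⟩
  filter_upwards [hc ε hε, hd ε hε] with m h₁ h₂
  exact Submodule.add_mem _
    (Finsupp.supported_mono (smallLists_mono Set.subset_union_left ε k) h₁)
    (Finsupp.supported_mono (smallLists_mono Set.subset_union_right ε k) h₂)

theorem Tame.mono {A B : Set X} (hAB : A ⊆ B) {k : ℕ} {c : ℕ → Chain X} (hc : Tame A k c) :
    Tame B k c := by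
  obtain ⟨K, hKA, hK, hc⟩ := hc
  exact ⟨K, hKA.trans hAB, hK, hc⟩

theorem boundary_mem_smallChains {K : Set X} {ε : ℝ} {k : ℕ} {c : Chain X}
    (hc : c ∈ smallChains K ε (k + 1)) : boundary c ∈ smallChains K ε k := by
  refine map_mem_supported (fun l hl => ?_) hc
  rw [boundary_simplex]
  refine Finsupp.supported_mono ?_ (listBoundary_mem_supported l)
  rintro l' ⟨h₁, h₂⟩
  exact ⟨by have := hl.1; omega, fun x hx => hl.2.1 x (h₂ x hx),
    fun x hx y hy => hl.2.2 x (h₂ x hx) y (h₂ y hy)⟩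

theorem Tame.boundary {A : Set X} {k : ℕ} {c : ℕ → Chain X} (hc : Tame A (k + 1) c) :
    Tame A k fun m => boundary (c m) := by
  obtain ⟨K, hKA, hK, hc⟩ := hc
  exact ⟨K, hKA, hK, fun ε hε => (hc ε hε).mono fun m => boundary_mem_smallChains⟩

theorem Tame.push {A : Set X} {B : Set Y} {f : X → Y} (hf : ContinuousOn f A)
    (hAB : Set.MapsTo f A B) {k : ℕ} {c : ℕ → Chain X} (hc : Tame A k c) :
    Tame B k fun m => push f (c m) := by
  obtain ⟨K, hKA, hK, hc⟩ := hc
  have hfK := hf.mono hKA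
  refine ⟨f '' K, ?_, hK.image_of_continuousOn hfK, fun ε hε => ?_⟩
  · rintro _ ⟨x, hx, rfl⟩
    exact hAB (hKA hx)
  obtain ⟨δ, hδ, hfδ⟩ :=
    Metric.uniformContinuousOn_iff.1 (hK.uniformContinuousOn_of_continuous hfK) ε hε
  filter_upwards [hc δ hδ] with m hm
  refine map_mem_supported (fun l hl => ?_) hm
  rw [push_simplex]
  refine simplex_mem_supported ⟨by simp [hl.1], ?_, ?_⟩
  · intro y hy
    obtain ⟨x, hx, rfl⟩ := List.mem_map.1 hy
    exact ⟨x, hl.2.1 x hx, rfl⟩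
  · intro y hy y' hy'
    obtain ⟨x, hx, rfl⟩ := List.mem_map.1 hy
    obtain ⟨x', hx', rfl⟩ := List.mem_map.1 hy'
    exact hfδ x (hl.2.1 x hx) x' (hl.2.1 x' hx') (hl.2.2 x hx x' hx')

theorem tame_replicate {A : Set X} {x : X} (hx : x ∈ A) (k : ℕ) :
    Tame A k fun _ => simplex (List.replicate k x) := by
  refine ⟨{x}, by simpa using hx, isCompact_singleton, fun ε hε => .of_forall fun m => ?_⟩
  refine simplex_mem_supported ⟨by simp, ?_, ?_⟩
  · intro y hy
    simp [List.eq_of_mem_replicate hy]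
  · intro y hy y' hy'
    rw [List.eq_of_mem_replicate hy, List.eq_of_mem_replicate hy', dist_self]
    exact hε

/-- The prism of a homotopy on the subdivision of the unit interval into `m + 1` pieces. -/
noncomputable def homotopyPrism (h : ℝ → X → Y) (m : ℕ) : Chain X →ₗ[ZMod 2] Chain Y :=
  ∑ i ∈ Finset.range (m + 1), prism (h (i / (m + 1 : ℝ))) (h ((i + 1 : ℕ) / (m + 1 : ℝ)))

omit [PseudoMetricSpace X] [PseudoMetricSpace Y] in
theorem boundary_homotopyPrism_add (h : ℝ → X → Y) (m : ℕ) (c : Chain X) :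
    boundary (homotopyPrism h m c) + homotopyPrism h m (boundary c) =
      push (h 0) c + push (h 1) c := by
  have key : ∀ N : ℕ, ∑ i ∈ Finset.range N, (push (h (i / (m + 1 : ℝ))) c +
      push (h ((i + 1 : ℕ) / (m + 1 : ℝ))) c) =
      push (h 0) c + push (h (N / (m + 1 : ℝ))) c := by
    intro N
    induction N with
    | zero => simp [ZModModule.add_self]
    | succ N ih =>
      rw [Finset.sum_range_succ, ih]
      have := ZModModule.add_self (push (h (N / (m + 1 : ℝ))) c)
      grind
  have h1 : ((m + 1 : ℕ) : ℝ) / (m + 1 : ℝ) = 1 := by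
    push_cast
    exact div_self (by positivity)
  simp only [homotopyPrism, LinearMap.sum_apply, map_sum, ← Finset.sum_add_distrib,
    boundary_prism_add]
  rw [key, h1]

theorem Tame.homotopyPrism {A : Set X} {B : Set Y} {h : ℝ → X → Y}
    (hcont : ContinuousOn (fun p : ℝ × X => h p.1 p.2) (Set.Icc 0 1 ×ˢ A))
    (hAB : ∀ t ∈ Set.Icc (0 : ℝ) 1, Set.MapsTo (h t) A B) {k : ℕ} {c : ℕ → Chain X}
    (hc : Tame A k c) : Tame B (k + 1) fun m => homotopyPrism h m (c m) := by
  obtain ⟨K, hKA, hK, hc⟩ := hc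
  have hIK : IsCompact (Set.Icc (0 : ℝ) 1 ×ˢ K) := isCompact_Icc.prod hK
  have hfK := hcont.mono (Set.prod_mono_right hKA)
  refine ⟨_, ?_, hIK.image_of_continuousOn hfK, fun ε hε => ?_⟩
  · rintro _ ⟨⟨t, x⟩, ⟨ht, hx⟩, rfl⟩
    exact hAB t ht (hKA hx)
  obtain ⟨δ, hδ, hfδ⟩ :=
    Metric.uniformContinuousOn_iff.1 (hIK.uniformContinuousOn_of_continuous hfK) ε hε
  filter_upwards [hc δ hδ, Nat.hyperfilter_le_atTop <|
    (tendsto_one_div_add_atTop_nhds_zero_nat (𝕜 := ℝ)).eventually (gt_mem_nhds hδ)] with m hm hmδ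
  rw [SmallChains.homotopyPrism, LinearMap.sum_apply]
  refine Submodule.sum_mem _ fun i hi => ?_
  rw [Finset.mem_range] at hi
  have hm0 : (0 : ℝ) < m + 1 := by positivity
  have hi1 : (i : ℝ) + 1 ≤ m + 1 := by exact_mod_cast hi
  have hsub : ∀ s : ℝ, s = i / (m + 1 : ℝ) ∨ s = (i + 1 : ℕ) / (m + 1 : ℝ) →
      s ∈ Set.Icc (i / (m + 1 : ℝ)) (i / (m + 1 : ℝ) + 1 / (m + 1)) ∧ s ∈ Set.Icc (0 : ℝ) 1 := by
    have hpos : 0 ≤ (i : ℝ) / (m + 1) := by positivity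
    have hpos' : 0 ≤ 1 / ((m : ℝ) + 1) := by positivity
    have hle : (i : ℝ) / (m + 1) + 1 / (m + 1) ≤ 1 := by
      rw [← add_div, div_le_one hm0]
      exact hi1
    rintro s (rfl | rfl)
    · exact ⟨⟨le_rfl, by linarith⟩, hpos, by linarith⟩
    · push_cast
      rw [add_div]
      exact ⟨⟨by linarith, le_rfl⟩, by linarith, hle⟩
  refine map_mem_supported (fun l hl => ?_) hm
  rw [prism_simplex]
  refine Finsupp.supported_mono ?_ (listPrism_mem_supported _ _ l)
  rintro l' ⟨h₁, h₂⟩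
  have h₃ : ∀ y ∈ l', ∃ x ∈ l, ∃ s, s ∈ Set.Icc (i / (m + 1 : ℝ)) (i / (m + 1 : ℝ) + 1 / (m + 1))
      ∧ s ∈ Set.Icc (0 : ℝ) 1 ∧ y = h s x := by
    intro y hy
    obtain ⟨x, hx, h⟩ := h₂ y hy
    rcases h with h | h
    · exact ⟨x, hx, _, (hsub _ (Or.inl rfl)).1, (hsub _ (Or.inl rfl)).2, h⟩
    · exact ⟨x, hx, _, (hsub _ (Or.inr rfl)).1, (hsub _ (Or.inr rfl)).2, h⟩
  refine ⟨by rw [h₁, hl.1], ?_, ?_⟩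
  · intro y hy
    obtain ⟨x, hx, s, -, hs, rfl⟩ := h₃ y hy
    exact ⟨(s, x), ⟨hs, hl.2.1 x hx⟩, rfl⟩
  · intro y hy y' hy'
    obtain ⟨x, hx, s, hs, hs1, rfl⟩ := h₃ y hy
    obtain ⟨x', hx', s', hs', hs1', rfl⟩ := h₃ y' hy'
    refine hfδ (s, x) ⟨hs1, hl.2.1 x hx⟩ (s', x') ⟨hs1', hl.2.1 x' hx'⟩ ?_
    rw [Prod.dist_eq, max_lt_iff]
    refine ⟨lt_of_le_of_lt ?_ hmδ, hl.2.2 x hx x' hx'⟩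
    rw [Real.dist_eq, abs_le]
    constructor <;> linarith [hs.1, hs.2, hs'.1, hs'.2]

end Small

/-! ### Homology of families of small chains -/

section Homology

variable {X Y : Type*} [PseudoMetricSpace X] [PseudoMetricSpace Y]

/-- A tame family that eventually consists of cycles. -/
def IsCycle (A : Set X) (k : ℕ) (z : ℕ → Chain X) : Prop :=
  Tame A k z ∧ ∀ᶠ m in hyperfilter ℕ, boundary (z m) = 0

/-- A family that is eventually the boundary of a tame family. -/
def Bounds (A : Set X) (k : ℕ) (z : ℕ → Chain X) : Prop :=
  ∃ w, Tame A (k + 1) w ∧ ∀ᶠ m in hyperfilter ℕ, boundary (w m) = z m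

/-- Vanishing of the reduced homology in degree `k - 1`. -/
def Acyclic (A : Set X) (k : ℕ) : Prop :=
  ∀ z, IsCycle A k z → Bounds A k z

/-- The reduced homology in degree `k - 1` has at most one nonzero element. -/
def RankLeOne (A : Set X) (k : ℕ) : Prop :=
  ∀ z z', IsCycle A k z → IsCycle A k z' → Bounds A k z ∨ Bounds A k z' ∨ Bounds A k (z + z')

theorem IsCycle.add {A : Set X} {k : ℕ} {z z' : ℕ → Chain X} (hz : IsCycle A k z)
    (hz' : IsCycle A k z') : IsCycle A k (z + z') := by
  refine ⟨hz.1.add hz'.1, ?_⟩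
  filter_upwards [hz.2, hz'.2] with m h h'
  rw [Pi.add_apply, map_add, h, h', add_zero]

theorem Bounds.add {A : Set X} {k : ℕ} {z z' : ℕ → Chain X} (hz : Bounds A k z)
    (hz' : Bounds A k z') : Bounds A k (z + z') := by
  obtain ⟨w, hw, h⟩ := hz
  obtain ⟨w', hw', h'⟩ := hz'
  refine ⟨w + w', hw.add hw', ?_⟩
  filter_upwards [h, h'] with m h h'
  rw [Pi.add_apply, map_add, h, h', Pi.add_apply]

theorem Bounds.congr {A : Set X} {k : ℕ} {z z' : ℕ → Chain X} (hz : Bounds A k z)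
    (h : ∀ᶠ m in hyperfilter ℕ, z m = z' m) : Bounds A k z' := by
  obtain ⟨w, hw, hwz⟩ := hz
  refine ⟨w, hw, ?_⟩
  filter_upwards [h, hwz] with m h h'
  rw [h', h]

theorem Bounds.mono {A B : Set X} (hAB : A ⊆ B) {k : ℕ} {z : ℕ → Chain X} (hz : Bounds A k z) :
    Bounds B k z := by
  obtain ⟨w, hw, hwz⟩ := hz
  exact ⟨w, hw.mono hAB, hwz⟩

theorem IsCycle.push {A : Set X} {B : Set Y} {f : X → Y} (hf : ContinuousOn f A)
    (hAB : Set.MapsTo f A B) {k : ℕ} {z : ℕ → Chain X} (hz : IsCycle A k z) :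
    IsCycle B k fun m => push f (z m) := by
  refine ⟨hz.1.push hf hAB, ?_⟩
  filter_upwards [hz.2] with m h
  rw [boundary_push, h, map_zero]

theorem Bounds.push {A : Set X} {B : Set Y} {f : X → Y} (hf : ContinuousOn f A)
    (hAB : Set.MapsTo f A B) {k : ℕ} {z : ℕ → Chain X} (hz : Bounds A k z) :
    Bounds B k fun m => push f (z m) := by
  obtain ⟨w, hw, h⟩ := hz
  refine ⟨_, hw.push hf hAB, ?_⟩
  filter_upwards [h] with m h
  rw [boundary_push, h]

theorem RankLeOne.bounds_add_push {A : Set X} {k : ℕ} (hA : RankLeOne A k) {s : X → X}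
    (hs : ContinuousOn s A) (hsA : Set.MapsTo s A A) (hss : s ∘ s = id) {z : ℕ → Chain X}
    (hz : IsCycle A k z) : Bounds A k fun m => z m + push s (z m) := by
  rcases hA z _ hz (hz.push hs hsA) with h | h | h
  · exact h.add (h.push hs hsA)
  · have h' := h.push hs hsA
    refine (h'.add h).congr (.of_forall fun m => ?_)
    simp [push_push, hss, push_id]
  · exact h

/-- `A` is a retract of `B` up to homotopy. -/
def DominatedBy (A : Set X) (B : Set Y) : Prop :=
  ∃ (f : X → Y) (g : Y → X) (h : ℝ → X → X), ContinuousOn f A ∧ Set.MapsTo f A B ∧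
    ContinuousOn g B ∧ Set.MapsTo g B A ∧
    ContinuousOn (fun p : ℝ × X => h p.1 p.2) (Set.Icc 0 1 ×ˢ A) ∧
    (∀ t ∈ Set.Icc (0 : ℝ) 1, Set.MapsTo (h t) A A) ∧ h 0 = id ∧ h 1 = g ∘ f

theorem DominatedBy.exists_reflecting {A : Set X} {B : Set Y} (hAB : DominatedBy A B) :
    ∃ f : X → Y, ContinuousOn f A ∧ Set.MapsTo f A B ∧ ∀ k z, IsCycle A k z →
      Bounds B k (fun m => SmallChains.push f (z m)) → Bounds A k z := by
  obtain ⟨f, g, h, hf, hfA, hg, hgB, hh, hhA, h0, h1⟩ := hAB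
  refine ⟨f, hf, hfA, fun k z hz hb => ?_⟩
  have hH : Bounds A k fun m => z m + SmallChains.push (g ∘ f) (z m) := by
    refine ⟨_, hz.1.homotopyPrism hh hhA, ?_⟩
    filter_upwards [hz.2] with m hm
    have := boundary_homotopyPrism_add h m (z m)
    rwa [hm, map_zero, add_zero, h0, h1, push_id] at this
  refine (hH.add (hb.push hg hgB)).congr (.of_forall fun m => ?_)
  simp [push_push, add_assoc, ZModModule.add_self]

theorem DominatedBy.acyclic {A : Set X} {B : Set Y} (hAB : DominatedBy A B) {k : ℕ}
    (hB : Acyclic B k) : Acyclic A k := by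
  obtain ⟨f, hf, hfA, h⟩ := hAB.exists_reflecting
  exact fun z hz => h k z hz (hB _ (hz.push hf hfA))

theorem DominatedBy.rankLeOne {A : Set X} {B : Set Y} (hAB : DominatedBy A B) {k : ℕ}
    (hB : RankLeOne B k) : RankLeOne A k := by
  obtain ⟨f, hf, hfA, h⟩ := hAB.exists_reflecting
  intro z z' hz hz'
  refine (hB _ _ (hz.push hf hfA) (hz'.push hf hfA)).imp (h k z hz) (Or.imp (h k z' hz') ?_)
  intro hb
  exact h k _ (hz.add hz') (hb.congr (.of_forall fun m => by simp))

theorem acyclic_singleton (x : X) (k : ℕ) : Acyclic {x} k := by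
  rintro z ⟨⟨K, hKA, hK, hz⟩, hz0⟩
  refine ⟨fun m => cone x (z m), ⟨{x}, subset_rfl, isCompact_singleton, fun ε hε => ?_⟩, ?_⟩
  · filter_upwards [hz ε hε] with m hm
    refine map_mem_supported (fun l hl => ?_) hm
    rw [cone_simplex]
    have hmem : ∀ y ∈ x :: l, y = x := by
      intro y hy
      rcases List.mem_cons.1 hy with rfl | hy
      · rfl
      · exact hKA (hl.2.1 y hy)
    refine simplex_mem_supported ⟨by simp [hl.1], hmem, fun y hy y' hy' => ?_⟩
    rw [hmem y hy, hmem y' hy', dist_self]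
    exact hε
  · filter_upwards [hz0] with m hm
    rw [boundary_cone, hm, map_zero, add_zero]

theorem bounds_of_eventually_eq_zero (A : Set X) (k : ℕ) {z : ℕ → Chain X}
    (hz : ∀ᶠ m in hyperfilter ℕ, z m = 0) : Bounds A k z := by
  refine ⟨0, ⟨∅, Set.empty_subset A, isCompact_empty, fun ε hε => .of_forall fun m =>
    Submodule.zero_mem _⟩, ?_⟩
  filter_upwards [hz] with m hm
  simp [hm]

theorem acyclic_empty {k : ℕ} (hk : k ≠ 0) : Acyclic (∅ : Set X) k := by
  rintro z ⟨⟨K, hKA, hK, hz⟩, hz0⟩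
  refine bounds_of_eventually_eq_zero _ _ ?_
  filter_upwards [hz 1 one_pos] with m hm
  have : smallLists K 1 k = ∅ := by
    refine Set.eq_empty_of_forall_notMem fun l hl => ?_
    obtain ⟨x, hx⟩ := List.exists_mem_of_length_pos (by have := hl.1; omega : 0 < l.length)
    exact hKA (hl.2.1 x hx)
  rwa [smallChains, this, Finsupp.supported_empty, Submodule.mem_bot] at hm

theorem acyclic_zero {A : Set X} (hA : A.Nonempty) : Acyclic A 0 := by
  obtain ⟨x, hx⟩ := hA
  rintro z ⟨⟨K, hKA, hK, hz⟩, hz0⟩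
  refine ⟨fun m => cone x (z m), ⟨{x}, by simpa using hx, isCompact_singleton, fun ε hε => ?_⟩, ?_⟩
  · filter_upwards [hz 1 one_pos] with m hm
    refine map_mem_supported (fun l hl => ?_) hm
    rw [cone_simplex, List.length_eq_zero_iff.1 hl.1]
    exact simplex_mem_supported ⟨rfl, by simp, by simpa using hε⟩
  · filter_upwards [hz0] with m hm
    rw [boundary_cone, hm, map_zero, add_zero]

theorem rankLeOne_zero (A : Set X) : RankLeOne A 0 := by
  have key : ∀ z : ℕ → Chain X, IsCycle A 0 z →
      (∀ᶠ m in hyperfilter ℕ, z m = 0) ∨ ∀ᶠ m in hyperfilter ℕ, z m = simplex [] := by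
    rintro z ⟨⟨K, hKA, hK, hz⟩, hz0⟩
    rw [← Ultrafilter.eventually_or]
    filter_upwards [hz 1 one_pos] with m hm
    have h : z m = Finsupp.single [] (z m []) := by
      refine Finsupp.eq_single_iff.2 ⟨fun l hl => ?_, rfl⟩
      rw [Finset.mem_singleton]
      exact List.length_eq_zero_iff.1 (hm hl).1
    have h2 : ∀ c : ZMod 2, c = 0 ∨ c = 1 := by decide
    rcases h2 (z m []) with h0 | h0
    · left
      rw [h, h0, Finsupp.single_zero]
    · right
      rw [h, h0]
  intro z z' hz hz'
  rcases key z hz with h | h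
  · exact Or.inl (bounds_of_eventually_eq_zero _ _ h)
  rcases key z' hz' with h' | h'
  · exact Or.inr (Or.inl (bounds_of_eventually_eq_zero _ _ h'))
  refine Or.inr (Or.inr (bounds_of_eventually_eq_zero _ _ ?_))
  filter_upwards [h, h'] with m h h'
  rw [Pi.add_apply, h, h', ZModModule.add_self]

/-- A tame family in a union of two relatively open sets is a sum of tame families in each. -/
theorem Tame.exists_add {A U V : Set X} (hU : IsOpen U) (hV : IsOpen V) (hA : A ⊆ U ∪ V)
    {k : ℕ} {z : ℕ → Chain X} (hz : Tame A k z) :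
    ∃ a b, Tame (A ∩ U) k a ∧ Tame (A ∩ V) k b ∧ ∀ m, a m + b m = z m := by
  obtain ⟨K, hKA, hK, hz⟩ := hz
  obtain ⟨δ, hδ, hδK⟩ := lebesgue_number_lemma_of_metric (s := K)
    (c := fun b : Bool => cond b U V) hK (by rintro (_ | _) <;> assumption) (fun x hx => by
      rcases hA (hKA hx) with h | h
      · exact Set.mem_iUnion.2 ⟨true, h⟩
      · exact Set.mem_iUnion.2 ⟨false, h⟩)
  let core (W : Set X) : Set X := K ∩ {x | ENNReal.ofReal (δ / 2) ≤ Metric.infEDist x Wᶜ}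
  have hcore (W : Set X) : IsCompact (core W) :=
    hK.inter_right (isClosed_le continuous_const Metric.continuous_infEDist)
  have hcoreW (W : Set X) : core W ⊆ A ∩ W := by
    rintro x ⟨hx, hx'⟩
    refine ⟨hKA hx, by_contra fun h => ?_⟩
    rw [Set.mem_ofPred_eq, Metric.infEDist_zero_of_mem h, nonpos_iff_eq_zero,
      ENNReal.ofReal_eq_zero] at hx'
    linarith
  have hlist : ∀ l ∈ smallLists K (δ / 2) k, (∀ x ∈ l, x ∈ core U) ∨ ∀ x ∈ l, x ∈ core V := by
    intro l hl
    rcases List.eq_nil_or_concat' l with rfl | ⟨l', x, rfl⟩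
    · simp
    have hx : x ∈ l' ++ [x] := by simp
    obtain ⟨i, hi⟩ := hδK x (hl.2.1 x hx)
    have : ∀ y ∈ l' ++ [x], y ∈ core (cond i U V) := by
      intro y hy
      refine ⟨hl.2.1 y hy, Metric.le_infEDist.2 fun w hw => ?_⟩
      by_contra! hlt
      rw [edist_dist, ENNReal.ofReal_lt_ofReal_iff (by positivity)] at hlt
      have h1 := hl.2.2 y hy x hx
      refine hw (by
        have : w ∈ Metric.ball x δ := by
          rw [Metric.mem_ball]
          linarith [dist_triangle w y x, dist_comm w y]
        cases i <;> exact hi this)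
    cases i
    · exact Or.inr this
    · exact Or.inl this
  classical
  let a : ℕ → Chain X := fun m => (z m).filter fun l => ∀ x ∈ l, x ∈ core U
  let b : ℕ → Chain X := fun m => (z m).filter fun l => ¬ ∀ x ∈ l, x ∈ core U
  refine ⟨a, b, ⟨core U, hcoreW U, hcore U, fun ε hε => ?_⟩,
    ⟨core V, hcoreW V, hcore V, fun ε hε => ?_⟩, fun m => Finsupp.filter_add_filter_not _ _⟩
  · filter_upwards [hz ε hε] with m hm
    rw [Finsupp.mem_supported] at hm ⊢
    intro l hl
    simp only [a, Finsupp.support_filter, Finset.coe_filter, Set.mem_ofPred_eq] at hl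
    have := hm hl.1
    exact ⟨this.1, hl.2, this.2.2⟩
  · filter_upwards [hz ε hε, hz (δ / 2) (by positivity)] with m hm hm'
    rw [Finsupp.mem_supported] at hm hm' ⊢
    intro l hl
    simp only [b, Finsupp.support_filter, Finset.coe_filter, Set.mem_ofPred_eq] at hl
    have := hm hl.1
    exact ⟨this.1, (hlist l (hm' hl.1)).resolve_left hl.2, this.2.2⟩

variable [T2Space X]

/-- The connecting homomorphism of the Mayer-Vietoris sequence. -/
theorem connecting {A B : Set X} {k : ℕ} {z a b : ℕ → Chain X}
    (hz : ∀ᶠ m in hyperfilter ℕ, boundary (z m) = 0) (ha : Tame A (k + 1) a) (hb : Tame B (k + 1) b)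
    (hab : ∀ m, a m + b m = z m) (hA : Acyclic A (k + 1)) (hB : Acyclic B (k + 1)) :
    IsCycle (A ∩ B) k (fun m => boundary (a m)) ∧
      (Bounds (A ∩ B) k (fun m => boundary (a m)) → Bounds (A ∪ B) (k + 1) z) := by
  have heq : ∀ᶠ m in hyperfilter ℕ, boundary (b m) = boundary (a m) := by
    filter_upwards [hz] with m hm
    rw [← hab, map_add] at hm
    have := ZModModule.add_self (boundary (a m))
    grind
  refine ⟨⟨?_, .of_forall fun m => boundary_boundary _⟩, ?_⟩
  · obtain ⟨K, hKA, hK, haK⟩ := ha.boundary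
    obtain ⟨L, hLB, hL, hbL⟩ := hb.boundary
    refine ⟨K ∩ L, Set.inter_subset_inter hKA hLB, hK.inter hL, fun ε hε => ?_⟩
    filter_upwards [haK ε hε, hbL ε hε, heq] with m h₁ h₂ h₃ l hl
    rw [h₃] at h₂
    exact ⟨(h₁ hl).1, fun x hx => ⟨(h₁ hl).2.1 x hx, (h₂ hl).2.1 x hx⟩, (h₁ hl).2.2⟩
  · rintro ⟨d, hd, hda⟩
    have h₁ : Bounds A (k + 1) (a + d) := by
      refine hA _ ⟨ha.add (hd.mono Set.inter_subset_left), ?_⟩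
      filter_upwards [hda] with m hm
      rw [Pi.add_apply, map_add, hm, ZModModule.add_self]
    have h₂ : Bounds B (k + 1) (b + d) := by
      refine hB _ ⟨hb.add (hd.mono Set.inter_subset_right), ?_⟩
      filter_upwards [hda, heq] with m hm hm'
      rw [Pi.add_apply, map_add, hm, hm', ZModModule.add_self]
    refine ((h₁.mono Set.subset_union_left).add (h₂.mono Set.subset_union_right)).congr
      (.of_forall fun m => ?_)
    simp only [Pi.add_apply, ← hab]
    have := ZModModule.add_self (d m)
    grind

theorem acyclic_succ_of_cover {A U V : Set X} (hU : IsOpen U) (hV : IsOpen V) (hA : A ⊆ U ∪ V)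
    {k : ℕ} (hAU : Acyclic (A ∩ U) (k + 1)) (hAV : Acyclic (A ∩ V) (k + 1))
    (hUV : Acyclic (A ∩ U ∩ (A ∩ V)) k) : Acyclic A (k + 1) := by
  rintro z ⟨hz, hz0⟩
  obtain ⟨a, b, ha, hb, hab⟩ := hz.exists_add hU hV hA
  obtain ⟨h₁, h₂⟩ := connecting hz0 ha hb hab hAU hAV
  exact (h₂ (hUV _ h₁)).mono (by grind)

theorem rankLeOne_succ_of_cover {A U V : Set X} (hU : IsOpen U) (hV : IsOpen V)
    (hA : A ⊆ U ∪ V) {k : ℕ} (hAU : Acyclic (A ∩ U) (k + 1)) (hAV : Acyclic (A ∩ V) (k + 1))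
    (hUV : RankLeOne (A ∩ U ∩ (A ∩ V)) k) : RankLeOne A (k + 1) := by
  have hsub : A ∩ U ∪ A ∩ V ⊆ A := by grind
  rintro z z' ⟨hz, hz0⟩ ⟨hz', hz0'⟩
  obtain ⟨a, b, ha, hb, hab⟩ := hz.exists_add hU hV hA
  obtain ⟨a', b', ha', hb', hab'⟩ := hz'.exists_add hU hV hA
  obtain ⟨h₁, h₂⟩ := connecting hz0 ha hb hab hAU hAV
  obtain ⟨h₁', h₂'⟩ := connecting hz0' ha' hb' hab' hAU hAV
  obtain ⟨h₁'', h₂''⟩ := connecting (z := z + z') (a := a + a') (b := b + b')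
    (by filter_upwards [hz0, hz0'] with m h h'; simp [h, h']) (ha.add ha') (hb.add hb')
    (fun m => by simp only [Pi.add_apply, ← hab, ← hab']; abel) hAU hAV
  refine (hUV _ _ h₁ h₁').imp (fun h => (h₂ h).mono hsub)
    (Or.imp (fun h => (h₂' h).mono hsub) fun h => (h₂'' (h.congr ?_)).mono hsub)
  exact .of_forall fun m => by simp

end Homology

/-! ### Punctured subspaces and spheres -/

section Punctured

variable {E : Type*} [NormedAddCommGroup E] [InnerProductSpace ℝ E]

/-- The nonzero vectors of a subspace. -/
def punctured (F : Submodule ℝ E) : Set E := {x | x ∈ F ∧ x ≠ 0}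

theorem eq_zero_of_eq_neg {x : E} (h : x = -x) : x = 0 := by
  have : (2 : ℝ) • x = 0 := by
    rw [two_smul]
    exact add_eq_zero_iff_eq_neg.2 h
  simpa using this

theorem acyclic_slit {F : Submodule ℝ E} {e : E} (heF : e ∈ F) (he : ‖e‖ = 1) (k : ℕ) :
    Acyclic (punctured F ∩ {x | x ≠ -(‖x‖ • e)}) k := by
  have he0 : e ≠ 0 := by
    rintro rfl
    simp at he
  have hself : e ≠ -(‖e‖ • e) := by
    rw [he, one_smul]
    exact fun h => he0 (eq_zero_of_eq_neg h)
  refine DominatedBy.acyclic (B := {e}) ?_ (acyclic_singleton e k)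
  refine ⟨fun _ => e, id, fun t x => (1 - t) • x + t • e, continuousOn_const,
    fun _ _ => rfl, continuousOn_id, ?_, by fun_prop, ?_, ?_, ?_⟩
  · rintro _ rfl
    exact ⟨⟨heF, he0⟩, hself⟩
  · rintro t ⟨ht0, ht1⟩ x ⟨⟨hxF, -⟩, hx⟩
    have key : (1 - t) • x + t • e ≠ -(‖(1 - t) • x + t • e‖ • e) := by
      intro h
      set r := ‖(1 - t) • x + t • e‖ with hr
      have hr0 : 0 ≤ r := norm_nonneg _
      have h1 : (1 - t) • x = -((r + t) • e) := by
        rw [add_smul, neg_add, ← h]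
        abel
      have h2 : (1 - t) * ‖x‖ = r + t := by
        have := congrArg norm h1
        rwa [norm_neg, norm_smul, norm_smul, he, mul_one, Real.norm_of_nonneg (by linarith),
          Real.norm_of_nonneg (by linarith)] at this
      rw [← h2, mul_smul, ← smul_neg] at h1
      rcases eq_or_ne (1 - t) 0 with h0 | h0
      · rw [h0] at h2
        linarith
      · exact hx (smul_right_injective E h0 h1)
    refine ⟨⟨F.add_mem (F.smul_mem _ hxF) (F.smul_mem _ heF), fun h => key ?_⟩, key⟩
    change (1 - t) • x + t • e = 0 at h
    rw [h]
    simp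
  · ext x
    simp
  · ext x
    simp

theorem dominatedBy_punctured {F : Submodule ℝ E} {e : E} (heF : e ∈ F) (he : ‖e‖ = 1) :
    DominatedBy (punctured F ∩ {x | x ≠ -(‖x‖ • e)} ∩ (punctured F ∩ {x | x ≠ ‖x‖ • e}))
      (punctured ((Submodule.span ℝ {e})ᗮ ⊓ F)) := by
  have hee : inner ℝ e e = 1 := by
    rw [real_inner_self_eq_norm_sq, he, one_pow]
  have hset : punctured F ∩ {x | x ≠ -(‖x‖ • e)} ∩ (punctured F ∩ {x | x ≠ ‖x‖ • e}) =
      {x | x ∈ F ∧ ∀ b : ℝ, x ≠ b • e} := by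
    ext x
    constructor
    · rintro ⟨⟨⟨hxF, -⟩, h₁⟩, -, h₂⟩
      refine ⟨hxF, fun b hb => ?_⟩
      have hn : ‖x‖ = |b| := by
        rw [hb, norm_smul, he, mul_one, Real.norm_eq_abs]
      rcases abs_choice b with h | h
      · refine h₂ ?_
        rw [hn, h, hb]
      · refine h₁ ?_
        rw [hn, h, neg_smul, neg_neg, hb]
    · rintro ⟨hxF, h⟩
      have h0 : x ≠ 0 := by simpa using h 0
      exact ⟨⟨⟨hxF, h0⟩, by simpa using h (-‖x‖)⟩, ⟨hxF, h0⟩, h _⟩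
  rw [hset]
  refine ⟨fun x => x - inner ℝ e x • e, id, fun t x => x - (t * inner ℝ e x) • e,
    by fun_prop, ?_, continuousOn_id, ?_, by fun_prop, ?_, ?_, ?_⟩
  · rintro x ⟨hxF, hx⟩
    refine ⟨⟨?_, F.sub_mem hxF (F.smul_mem _ heF)⟩, fun h => hx _ (sub_eq_zero.1 h)⟩
    rw [SetLike.mem_coe, Submodule.mem_orthogonal_singleton_iff_inner_right, inner_sub_right,
      inner_smul_right, hee, mul_one, sub_self]
  · rintro x ⟨⟨hxe, hxF⟩, hx⟩
    refine ⟨hxF, fun b hb => hx ?_⟩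
    rw [SetLike.mem_coe, Submodule.mem_orthogonal_singleton_iff_inner_right] at hxe
    change x = b • e at hb
    rw [hb, inner_smul_right, hee, mul_one] at hxe
    simpa [hxe] using hb
  · rintro t - x ⟨hxF, hx⟩
    refine ⟨F.sub_mem hxF (F.smul_mem _ heF), fun b hb => hx (b + t * inner ℝ e x) ?_⟩
    rw [add_smul, ← hb, sub_add_cancel]
  · ext x
    simp
  · ext x
    simp

theorem punctured_homology [FiniteDimensional ℝ E] (d : ℕ) :
    ∀ F : Submodule ℝ E, Module.finrank ℝ F = d →
      (∀ k ≠ d, Acyclic (punctured F) k) ∧ RankLeOne (punctured F) d := by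
  induction d with
  | zero =>
    intro F hF
    have : punctured F = ∅ := by
      rw [Submodule.finrank_eq_zero.1 hF]
      exact Set.eq_empty_of_forall_notMem fun x hx => hx.2 ((Submodule.mem_bot ℝ).1 hx.1)
    rw [this]
    exact ⟨fun k => acyclic_empty, rankLeOne_zero _⟩
  | succ d ih =>
    intro F hF
    obtain ⟨v, hv⟩ : ∃ v : F, v ≠ 0 := by
      have : Nontrivial F := Module.nontrivial_of_finrank_pos (R := ℝ) (by omega)
      exact exists_ne 0
    have hv0 : (v : E) ≠ 0 := by simpa using hv
    obtain ⟨e, heF, he⟩ : ∃ e ∈ F, ‖e‖ = 1 :=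
      ⟨(‖(v : E)‖⁻¹ : ℝ) • (v : E), F.smul_mem _ v.2, norm_smul_inv_norm (𝕜 := ℝ) hv0⟩
    have he0 : e ≠ 0 := by
      rintro rfl
      simp at he
    have hF' : Module.finrank ℝ ((Submodule.span ℝ {e})ᗮ ⊓ F : Submodule ℝ E) = d := by
      have := Submodule.finrank_add_inf_finrank_orthogonal
        (K₁ := Submodule.span ℝ {e}) (K₂ := F) (by simpa using heF)
      rw [finrank_span_singleton he0, hF] at this
      omega
    obtain ⟨h₁, h₂⟩ := ih _ hF'
    have hU : IsOpen {x : E | x ≠ -(‖x‖ • e)} :=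
      isOpen_ne_fun (by fun_prop) (by fun_prop)
    have hV : IsOpen {x : E | x ≠ ‖x‖ • e} :=
      isOpen_ne_fun (by fun_prop) (by fun_prop)
    have hUV : punctured F ⊆ {x | x ≠ -(‖x‖ • e)} ∪ {x | x ≠ ‖x‖ • e} := by
      rintro x ⟨-, hx⟩
      by_contra! h
      simp only [Set.mem_union, Set.mem_ofPred_eq, not_or, not_not] at h
      have : ‖x‖ • e = 0 := eq_zero_of_eq_neg (h.2.symm.trans h.1)
      simp [he0, hx] at this
    have hAU (k) := acyclic_slit heF he k
    have hAV (k) : Acyclic (punctured F ∩ {x | x ≠ ‖x‖ • e}) k := by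
      simpa using acyclic_slit (F.neg_mem heF) ((norm_neg e).trans he) k
    refine ⟨fun k hk => ?_, ?_⟩
    · rcases k with _ | k
      · exact acyclic_zero ⟨e, heF, he0⟩
      · exact acyclic_succ_of_cover hU hV hUV (hAU _) (hAV _)
          ((dominatedBy_punctured heF he).acyclic (h₁ k (by omega)))
    · exact rankLeOne_succ_of_cover hU hV hUV (hAU _) (hAV _)
        ((dominatedBy_punctured heF he).rankLeOne h₂)

end Punctured

section Sphere

variable {n : ℕ}

/-- The unit vector in the direction of a nonzero vector. -/
noncomputable def toSphere (x : EuclideanSpace ℝ (Fin (n + 1))) : Sph n :=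
  if h : x = 0 then ⟨EuclideanSpace.single 0 1, by simp⟩
  else ⟨‖x‖⁻¹ • x, by simpa using norm_smul_inv_norm (𝕜 := ℝ) h⟩

theorem coe_toSphere {x : EuclideanSpace ℝ (Fin (n + 1))} (hx : x ≠ 0) :
    (toSphere x : EuclideanSpace ℝ (Fin (n + 1))) = ‖x‖⁻¹ • x := by
  rw [toSphere, dif_neg hx]

theorem sphere_ne_zero (x : Sph n) : (x : EuclideanSpace ℝ (Fin (n + 1))) ≠ 0 :=
  ne_zero_of_mem_unit_sphere x

theorem toSphere_coe (x : Sph n) : toSphere (x : EuclideanSpace ℝ (Fin (n + 1))) = x := by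
  ext1
  rw [coe_toSphere (sphere_ne_zero x)]
  simp

theorem continuousOn_toSphere :
    ContinuousOn (toSphere : EuclideanSpace ℝ (Fin (n + 1)) → Sph n) {x | x ≠ 0} := by
  rw [Topology.IsInducing.subtypeVal.continuousOn_iff]
  have : ContinuousOn (fun x : EuclideanSpace ℝ (Fin (n + 1)) => ‖x‖⁻¹ • x) {x | x ≠ 0} :=
    (continuousOn_id.norm.inv₀ fun x hx => norm_ne_zero_iff.2 hx).smul continuousOn_id
  exact this.congr fun x hx => coe_toSphere hx

theorem sphere_homology (n : ℕ) : (∀ k ≠ n + 1, Acyclic (Set.univ : Set (Sph n)) k) ∧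
    RankLeOne (Set.univ : Set (Sph n)) (n + 1) := by
  have hdom : DominatedBy (Set.univ : Set (Sph n))
      (punctured (⊤ : Submodule ℝ (EuclideanSpace ℝ (Fin (n + 1))))) := by
    refine ⟨Subtype.val, toSphere, fun _ => id, by fun_prop,
      fun x _ => ⟨trivial, sphere_ne_zero x⟩, continuousOn_toSphere.mono fun x hx => hx.2,
      Set.mapsTo_univ _ _, by fun_prop, fun _ _ => Set.mapsTo_univ _ _, rfl, ?_⟩
    ext1 x
    exact (toSphere_coe x).symm
  obtain ⟨h₁, h₂⟩ := punctured_homology (n + 1)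
    (⊤ : Submodule ℝ (EuclideanSpace ℝ (Fin (n + 1)))) (by simp)
  exact ⟨fun k hk => hdom.acyclic (h₁ k hk), hdom.rankLeOne h₂⟩

/-- The pairs of points of the sphere off the graph of `T`. -/
def offGraph (T : Sph n → Sph n) : Set (Sph n × Sph n) := {p | p.2 ≠ T p.1}

theorem dominatedBy_offGraph {T : Sph n → Sph n} (hT : Continuous T) :
    DominatedBy (offGraph T) (Set.univ : Set (Sph n)) := by
  let v : ℝ → Sph n × Sph n → EuclideanSpace ℝ (Fin (n + 1)) :=
    fun t p => (1 - t) • (p.2 : EuclideanSpace ℝ (Fin (n + 1))) - t • (T p.1 : _)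
  have hv : ∀ t ∈ Set.Icc (0 : ℝ) 1, ∀ p ∈ offGraph T, ∀ r : ℝ, 0 ≤ r →
      v t p ≠ r • (T p.1 : EuclideanSpace ℝ (Fin (n + 1))) := by
    rintro t ⟨ht0, ht1⟩ p hp r hr h
    have h1 : (1 - t) • (p.2 : EuclideanSpace ℝ (Fin (n + 1))) =
        (r + t) • (T p.1 : EuclideanSpace ℝ (Fin (n + 1))) := by
      rw [add_smul, ← h, sub_add_cancel]
    have h2 : 1 - t = r + t := by
      have := congrArg norm h1
      rwa [norm_smul, norm_smul, norm_eq_of_mem_sphere, norm_eq_of_mem_sphere, mul_one, mul_one,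
        Real.norm_of_nonneg (by linarith), Real.norm_of_nonneg (by linarith)] at this
    rw [← h2] at h1
    have h0 : 1 - t ≠ 0 := fun h0 => by linarith
    exact hp (Subtype.ext (smul_right_injective _ h0 h1))
  have hv0 : ∀ t ∈ Set.Icc (0 : ℝ) 1, ∀ p ∈ offGraph T, v t p ≠ 0 := fun t ht p hp => by
    simpa using hv t ht p hp 0 le_rfl
  refine ⟨Prod.fst, fun y => (y, toSphere (-(T y : EuclideanSpace ℝ (Fin (n + 1))))),
    fun t p => (p.1, toSphere (v t p)), by fun_prop, Set.mapsTo_univ _ _, ?_, ?_, ?_, ?_, ?_, ?_⟩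
  · refine continuousOn_id.prodMk (continuousOn_toSphere.comp (by fun_prop) fun y _ => ?_)
    exact neg_ne_zero.2 (sphere_ne_zero _)
  · intro y _ h
    have h' := congrArg Subtype.val h
    simp only [coe_toSphere (neg_ne_zero.2 (sphere_ne_zero (T y)))] at h'
    simp only [norm_neg, norm_eq_of_mem_sphere, inv_one, one_smul] at h'
    exact sphere_ne_zero (T y) (eq_zero_of_eq_neg h'.symm)
  · refine ContinuousOn.prodMk (by fun_prop) (continuousOn_toSphere.comp (by fun_prop) ?_)
    rintro ⟨t, p⟩ ⟨ht, hp⟩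
    exact hv0 t ht p hp
  · intro t ht p hp h
    refine hv t ht p hp ‖v t p‖ (norm_nonneg _) ?_
    have h' := congrArg Subtype.val h
    simp only [coe_toSphere (hv0 t ht p hp)] at h'
    rw [← h', smul_inv_smul₀ (norm_ne_zero_iff.2 (hv0 t ht p hp))]
  · ext1 p
    simp [v, toSphere_coe]
  · ext1 p
    simp [v]

end Sphere

/-! ### Parity of chains with respect to antisymmetric labels -/

section Parity

variable {X : Type*}

/-- The product over the edges of a simplex of the coboundaries of the functions
`σ i, σ (i + 1), …`. -/
noncomputable def listFull (σ : ℕ → X → ZMod 2) : ℕ → List X → ZMod 2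
  | _, [] => 0
  | _, [_] => 1
  | i, x :: y :: l => (σ i x + σ i y) * listFull σ (i + 1) (y :: l)

/-- The product of the coboundaries of `σ i, σ (i + 1), …` over the edges of a simplex and of
the next function at its last vertex. -/
noncomputable def listHalf (σ : ℕ → X → ZMod 2) : ℕ → List X → ZMod 2
  | _, [] => 0
  | i, [x] => σ i x
  | i, x :: y :: l => (σ i x + σ i y) * listHalf σ (i + 1) (y :: l)

/-- The linear extension of `listHalf`. -/
noncomputable def half (σ : ℕ → X → ZMod 2) (i : ℕ) : Chain X →ₗ[ZMod 2] ZMod 2 :=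
  Finsupp.linearCombination (ZMod 2) (listHalf σ i)

@[simp] theorem half_simplex (σ : ℕ → X → ZMod 2) (i : ℕ) (l : List X) :
    half σ i (simplex l) = listHalf σ i l := by
  simp [half]

theorem half_cone_cone (σ : ℕ → X → ZMod 2) (i : ℕ) (x y : X) (c : Chain X) :
    half σ i (cone x (cone y c)) = (σ i x + σ i y) * half σ (i + 1) (cone y c) := by
  have : half σ i ∘ₗ cone x ∘ₗ cone y =
      (σ i x + σ i y) • (half σ (i + 1) ∘ₗ cone y) :=
    linearMap_ext fun l => by simp [listHalf]
  exact LinearMap.congr_fun this c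

theorem listHalf_add_map {σ : ℕ → X → ZMod 2} {T : X → X}
    (hσ : ∀ i x, σ i (T x) = σ i x + 1) (i : ℕ) (l : List X) :
    listHalf σ i l + listHalf σ i (l.map T) = listFull σ i l := by
  have h2 : (2 : ZMod 2) = 0 := rfl
  induction l generalizing i with
  | nil => simp [listHalf, listFull]
  | cons x l ih =>
    cases l with
    | nil =>
      simp only [List.map_cons, List.map_nil, listHalf, listFull, hσ]
      linear_combination σ i x * h2
    | cons y l =>
      have := ih (i + 1)
      simp only [List.map_cons, listHalf, listFull, hσ] at this ⊢
      rw [← this]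
      linear_combination listHalf σ (i + 1) (T y :: l.map T) * h2

theorem half_listBoundary (σ : ℕ → X → ZMod 2) (i : ℕ) {l : List X} (hl : 2 ≤ l.length) :
    half σ i (listBoundary l) = listFull σ i l := by
  have h2 : (2 : ZMod 2) = 0 := rfl
  induction l generalizing i with
  | nil => simp at hl
  | cons x l ih =>
    match l with
    | [] => simp at hl
    | [y] =>
      simp [listBoundary, listFull, listHalf]
      ring
    | y :: w :: l =>
      have := ih (i + 1) (by simp)
      rw [listBoundary, map_add, half_simplex] at this
      rw [listBoundary, listBoundary, map_add, map_add, map_add, half_cone_cone, half_simplex,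
        cone_simplex, half_simplex]
      simp only [listHalf, listFull] at this ⊢
      rw [← this]
      linear_combination (σ i w * listHalf σ (i + 1) (w :: l)) * h2

theorem listFull_eq_zero {σ : ℕ → X → ZMod 2} {i j : ℕ} {l : List X} (hij : i ≤ j)
    (hj : j + 2 ≤ i + l.length) {c : ZMod 2} (hc : ∀ x ∈ l, σ j x = c) :
    listFull σ i l = 0 := by
  induction l generalizing i with
  | nil => rfl
  | cons x l ih =>
    cases l with
    | nil =>
      simp at hj
      omega
    | cons y l =>
      rw [listFull]
      rcases hij.eq_or_lt with rfl | hlt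
      · rw [hc x (by simp), hc y (by simp), ZModModule.add_self, zero_mul]
      · rw [ih hlt (by simp at hj ⊢; omega) fun w hw => hc w (by simp [hw]), mul_zero]

end Parity

theorem exists_antisymmetric_labels {X : Type*} [MetricSpace X] [CompactSpace X] {T : X → X}
    (hT : Continuous T) (hTT : ∀ x, T (T x) = x) (hfix : ∀ x, T x ≠ x) :
    ∃ (N : ℕ) (σ : ℕ → X → ZMod 2), ∃ δ > 0, (∀ i x, σ i (T x) = σ i x + 1) ∧
      ∀ l : List X, l ≠ [] → (∀ x ∈ l, ∀ y ∈ l, dist x y < δ) →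
        ∃ i < N, ∃ c, ∀ x ∈ l, σ i x = c := by
  classical
  have h11 : (1 : ZMod 2) + 1 = 0 := rfl
  have hball : ∀ p : X, ∃ r > 0, ∀ x ∈ Metric.ball p r, T x ∉ Metric.ball p r := by
    intro p
    obtain ⟨U, V, hU, hV, hpU, hpV, hUV⟩ := t2_separation (hfix p).symm
    obtain ⟨r, hr, hrU⟩ := Metric.isOpen_iff.1 (hU.inter (hV.preimage hT)) p ⟨hpU, hpV⟩
    exact ⟨r, hr, fun x hx hx' => Set.disjoint_left.1 hUV (hrU hx').1 (hrU hx).2⟩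
  choose r hr hrT using hball
  obtain ⟨t, ht⟩ := isCompact_univ.elim_finite_subcover (fun p : X => Metric.ball p (r p))
    (fun p => Metric.isOpen_ball) fun p _ => Set.mem_iUnion.2 ⟨p, Metric.mem_ball_self (hr p)⟩
  let e := t.equivFin
  obtain ⟨δ, hδ, hδt⟩ := lebesgue_number_lemma_of_metric (s := (Set.univ : Set X))
    (c := fun i => Metric.ball (e.symm i : X) (r (e.symm i))) isCompact_univ
    (fun i => Metric.isOpen_ball) (fun x hx => by
      obtain ⟨p, hp, hxp⟩ := Set.mem_iUnion₂.1 (ht hx)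
      exact Set.mem_iUnion.2 ⟨e ⟨p, hp⟩, by simpa using hxp⟩)
  let σ₀ : X → ZMod 2 := fun x => if WellOrderingRel x (T x) then 1 else 0
  have hσ₀ : ∀ x, σ₀ (T x) = σ₀ x + 1 := by
    intro x
    simp only [σ₀, hTT]
    rcases trichotomous_of WellOrderingRel x (T x) with h | h | h
    · rw [if_pos h, if_neg (asymm_of WellOrderingRel h), h11]
    · exact absurd h.symm (hfix x)
    · rw [if_pos h, if_neg (asymm_of WellOrderingRel h), zero_add]
  let label : X → X → ZMod 2 := fun p x =>
    if x ∈ Metric.ball p (r p) then 1 else if T x ∈ Metric.ball p (r p) then 0 else σ₀ x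
  have hlabel : ∀ p x, label p (T x) = label p x + 1 := by
    intro p x
    simp only [label, hTT, hσ₀]
    by_cases h : x ∈ Metric.ball p (r p)
    · rw [if_neg (hrT p x h), if_pos h, if_pos h, h11]
    · by_cases h' : T x ∈ Metric.ball p (r p)
      · rw [if_pos h', if_neg h, if_pos h', zero_add]
      · rw [if_neg h', if_neg h, if_neg h, if_neg h']
  refine ⟨t.card, fun i => if h : i < t.card then label (e.symm ⟨i, h⟩) else σ₀, δ, hδ, ?_, ?_⟩
  · intro i x
    by_cases h : i < t.card
    · simp only [dif_pos h, hlabel]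
    · simp only [dif_neg h, hσ₀]
  · intro l hl hlδ
    obtain ⟨x, hx⟩ := List.exists_mem_of_ne_nil l hl
    obtain ⟨i, hi⟩ := hδt x trivial
    refine ⟨i, i.2, 1, fun y hy => ?_⟩
    simp only [dif_pos i.2, label]
    exact if_pos (hi (hlδ y hy x hx))

/-! ### Milnor's theorem -/

section Antisymmetric

variable {X : Type*} {T : X → X} {σ : ℕ → X → ZMod 2}

theorem half_simplex_add_push (hσ : ∀ i x, σ i (T x) = σ i x + 1) (l : List X) :
    half σ 0 (simplex l + push T (simplex l)) = listFull σ 0 l := by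
  rw [map_add, push_simplex, half_simplex, half_simplex, listHalf_add_map hσ]

theorem half_boundary_eq [PseudoMetricSpace X] (hσ : ∀ i x, σ i (T x) = σ i x + 1)
    {K : Set X} {δ : ℝ} {k : ℕ}
    {c : Chain X} (hc : c ∈ smallChains K δ (k + 2)) :
    half σ 0 (boundary c) = half σ 0 (c + push T c) := by
  refine eqOn_supported (φ := half σ 0 ∘ₗ boundary)
    (ψ := half σ 0 ∘ₗ (LinearMap.id + push T)) (fun l hl => ?_) hc
  simp only [LinearMap.comp_apply, LinearMap.add_apply, LinearMap.id_apply,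
    half_simplex_add_push hσ]
  rw [boundary_simplex, half_listBoundary σ 0 (by have := hl.1; omega)]

theorem half_add_push_eq_zero [PseudoMetricSpace X] (hσ : ∀ i x, σ i (T x) = σ i x + 1)
    {δ : ℝ} {N : ℕ}
    (hσδ : ∀ l : List X, l ≠ [] → (∀ x ∈ l, ∀ y ∈ l, dist x y < δ) →
      ∃ i < N, ∃ a, ∀ x ∈ l, σ i x = a) {K : Set X} {c : Chain X}
    (hc : c ∈ smallChains K δ (N + 1)) : half σ 0 (c + push T c) = 0 := by
  refine eqOn_supported (φ := half σ 0 ∘ₗ (LinearMap.id + push T)) (ψ := 0)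
    (fun l hl => ?_) hc
  obtain ⟨i, hi, a, ha⟩ := hσδ l (List.ne_nil_of_length_eq_add_one hl.1) hl.2.2
  simp only [LinearMap.comp_apply, LinearMap.add_apply, LinearMap.id_apply,
    half_simplex_add_push hσ]
  exact listFull_eq_zero (Nat.zero_le i) (by have := hl.1; omega) ha

end Antisymmetric

theorem mapsTo_swap_offGraph {n : ℕ} {T : Sph n → Sph n} (hTT : ∀ x, T (T x) = x) :
    Set.MapsTo Prod.swap (offGraph T) (offGraph T) := by
  rintro ⟨a, b⟩ h h'
  exact h (by simpa [hTT] using (congrArg T h').symm)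

/-- The induction step: `F = (f, f ∘ T)` sends `z + T z` to a class in the complement of the
graph of `T` of the form `y + swap y`. -/
theorem bounds_add_push_of_offGraph {n : ℕ} {T : Sph n → Sph n} (hT : Continuous T)
    (hTT : ∀ x, T (T x) = x) (f : Sph n ≃ₜ Sph n) {z : ℕ → Chain (Sph n)}
    {y : ℕ → Chain (Sph n × Sph n)} (hy : IsCycle (offGraph T) (n + 1) y)
    (hyz : ∀ᶠ m in hyperfilter ℕ, y m + push Prod.swap (y m) =
      push (fun x => (f x, f (T x))) (z m + push T (z m))) :
    Bounds Set.univ (n + 1) fun m => z m + push T (z m) := by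
  have hg : (f.symm ∘ Prod.fst) ∘ (fun x => (f x, f (T x))) = id := by
    ext1 x
    simp
  have h₁ : Bounds (offGraph T) (n + 1) fun m => y m + push Prod.swap (y m) :=
    ((dominatedBy_offGraph hT).rankLeOne (sphere_homology n).2).bounds_add_push
      continuous_swap.continuousOn (mapsTo_swap_offGraph hTT) Prod.swap_swap_eq hy
  have hc : ContinuousOn (f.symm ∘ Prod.fst) (offGraph T) :=
    (f.symm.continuous.comp continuous_fst).continuousOn
  have h₂ := (h₁.congr hyz).push hc (Set.mapsTo_univ _ _)
  refine h₂.congr (.of_forall fun m => ?_)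
  rw [push_push, hg, push_id]

/-- A homeomorphism of the sphere agrees at some point with its conjugate by a given free
involution. -/
theorem exists_commuting_point {n : ℕ} {T : Sph n → Sph n} (hT : Continuous T)
    (hTT : ∀ x, T (T x) = x) (hfix : ∀ x, T x ≠ x) (f : Sph n ≃ₜ Sph n) :
    ∃ x, f (T x) = T (f x) := by
  by_contra! hne
  have hTT' : T ∘ T = id := funext hTT
  obtain ⟨N, σ, δ, hδ, hσ, hσδ⟩ := exists_antisymmetric_labels hT hTT hfix
  obtain ⟨hacyclic, -⟩ := sphere_homology n
  have hdom := dominatedBy_offGraph hT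
  let F : Sph n → Sph n × Sph n := fun x => (f x, f (T x))
  have hF : Continuous F := by fun_prop
  have hFW : Set.MapsTo F Set.univ (offGraph T) := fun x _ => hne x
  have hFT : Prod.swap ∘ F = F ∘ T := by
    ext1 x
    simp [F, hTT]
  have hswap := mapsTo_swap_offGraph hTT
  have hTuniv : Set.MapsTo T Set.univ Set.univ := Set.mapsTo_univ _ _
  have main : ∀ k : ℕ, ∃ z, Tame (Set.univ : Set (Sph n)) (k + 1) z ∧
      (∀ᶠ m in hyperfilter ℕ, boundary (z m + push T (z m)) = 0) ∧
      (∀ᶠ m in hyperfilter ℕ, half σ 0 (z m + push T (z m)) = 1) ∧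
      (k ≤ n → ∃ y, IsCycle (offGraph T) (k + 1) y ∧ ∀ᶠ m in hyperfilter ℕ,
        y m + push Prod.swap (y m) = push F (z m + push T (z m))) := by
    intro k
    induction k with
    | zero =>
      let x₀ : Sph n := toSphere 0
      have hw : (x₀, x₀) ∈ offGraph T := (hfix x₀).symm
      refine ⟨_, tame_replicate (Set.mem_univ x₀) 1, .of_forall fun m => ?_,
        .of_forall fun m => ?_, fun _ => ⟨_, ⟨((tame_replicate (Set.mem_univ x₀) 1).push
          hF.continuousOn hFW).add (tame_replicate hw 1), .of_forall fun m => ?_⟩,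
          .of_forall fun m => ?_⟩⟩
      · simp [listBoundary, ZModModule.add_self]
      · rw [half_simplex_add_push hσ]
        rfl
      · simp [listBoundary, ZModModule.add_self]
      · have hFT' : Prod.swap (F x₀) = F (T x₀) := congrFun hFT x₀
        simp only [Pi.add_apply, map_add, push_simplex, List.replicate_one, List.map_cons,
          List.map_nil, hFT', Prod.swap_prod_mk]
        rw [add_add_add_comm, ZModModule.add_self, add_zero]
    | succ k ih =>
      obtain ⟨z, hz, hz0, hz1, hzy⟩ := ih
      have hcycle : IsCycle Set.univ (k + 1) fun m => z m + push T (z m) :=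
        ⟨hz.add (hz.push hT.continuousOn hTuniv), hz0⟩
      have hbounds : Bounds Set.univ (k + 1) fun m => z m + push T (z m) := by
        rcases ne_or_eq k n with hk | rfl
        · exact hacyclic _ (by omega) _ hcycle
        obtain ⟨y, hy, hyz⟩ := hzy le_rfl
        exact bounds_add_push_of_offGraph hT hTT f hy hyz
      obtain ⟨z', hz', hzz'⟩ := hbounds
      refine ⟨z', hz', ?_, ?_, fun hk => ?_⟩
      · filter_upwards [hzz'] with m hm
        rw [map_add, boundary_push, hm, map_add, push_push, hTT', push_id,
          add_comm (push T (z m)), ZModModule.add_self]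
      · obtain ⟨K, -, -, hK⟩ := hz'
        filter_upwards [hzz', hz1, hK δ hδ] with m hm hm1 hmK
        rw [← half_boundary_eq hσ hmK, hm, hm1]
      · obtain ⟨y, hy, hyz⟩ := hzy (by omega)
        obtain ⟨D, hD, hDy⟩ := hdom.acyclic (hacyclic (k + 1) (by omega)) y hy
        refine ⟨_, ⟨(hz'.push hF.continuousOn hFW).add
          (hD.add (hD.push continuous_swap.continuousOn hswap)), ?_⟩, .of_forall fun m => ?_⟩
        · filter_upwards [hyz, hzz', hDy] with m h₁ h₂ h₃
          simp only [Pi.add_apply, map_add, boundary_push, h₂, h₃, h₁]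
          simp only [← map_add, ZModModule.add_self]
        · simp only [Pi.add_apply, map_add, push_push, hFT, Prod.swap_swap_eq, push_id]
          rw [add_add_add_comm, add_comm (push Prod.swap (D m)), ZModModule.add_self, add_zero]
  obtain ⟨z, ⟨K, -, -, hz⟩, -, h1, -⟩ := main N
  obtain ⟨m, hm, hm1⟩ := ((hz δ hδ).and h1).exists
  rw [half_add_push_eq_zero hσ hσδ hm] at hm1
  exact zero_ne_one hm1

end SmallChains

/-- **Milnor's theorem (1957).** If a finite group `G` acts freely and continuously on the
sphere `S^n` for some `n ≥ 0`, then every element of order 2 in `G` is central: every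
`g : G` with `g ^ 2 = 1` lies in the center of `G`. -/
theorem milnor_involutions_central_of_free_action_on_sphere
    (G : Type) [Group G] [Finite G] (n : ℕ)
    (φ : G →* (Sph n ≃ₜ Sph n))
    (hfree : ∀ (g : G) (x : Sph n), φ g x = x → g = 1) :
    ∀ g : G, g ^ 2 = 1 → g ∈ Subgroup.center G := by
  intro g hg
  rw [Subgroup.mem_center_iff]
  intro h
  rcases eq_or_ne g 1 with rfl | hg1
  · simp
  have hmul : ∀ (a b : G) (x : Sph n), φ (a * b) x = φ a (φ b x) := fun a b x => by
    rw [map_mul]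
    rfl
  have hone : ∀ x : Sph n, φ 1 x = x := fun x => by
    rw [map_one]
    rfl
  obtain ⟨x, hx⟩ := SmallChains.exists_commuting_point (T := φ g) (φ g).continuous
    (fun x => by rw [← hmul, ← pow_two, hg, hone]) (fun x hx => hg1 (hfree g x hx)) (φ h)
  rw [← hmul, ← hmul] at hx
  have := hfree ((g * h)⁻¹ * (h * g)) x (by rw [hmul, hx, ← hmul, inv_mul_cancel, hone])
  exact (inv_mul_eq_one.1 this).symm
end
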